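/- arXiv:math/0407517 — 9 statements merged into one kernel-verified Lean document; each statement's English description precedes it below -/
import Mathlib

section
/- Let (μ_n)_{n≥0} be a sequence of finite measures on (X, ℬ) with μ_{n+1}∘r^{-1} = μ_n for all n ≥ 0, let μ̂ be the unique measure on (X_∞(r), ℬ_∞) with μ̂∘θ_n^{-1} = μ_n, and let V : X → [0,∞) be measurable. If μ̂ is V-quasi-invariant, i.e., ∫ f∘r̂^{-1} dμ̂ = ∫ f·(V∘θ₀) dμ̂ for all bounded ℬ_∞-measurable f, then ∫_X f dμ₀ = ∫_X (f∘r)·V dμ₀ and ∫_X f dμ_{n+1} = ∫_X f·(V∘r^n) dμ_n for all bounded measurable f : X → ℝ and all n ≥ 0. -/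
open MeasureTheory Filter Topology Set

variable {X : Type*}

/-- The projective limit space `X_∞(r)`. -/
def SolSpace (r : X → X) : Type _ := {x : ℕ → X // ∀ n, r (x (n + 1)) = x n}

/-- Coordinate projection `θ_n`. -/
def theta (r : X → X) (n : ℕ) (x : SolSpace r) : X := x.1 n

/-- The inverse shift `r̂⁻¹ (x₀,x₁,…) = (x₁,x₂,…)`. -/
def shiftInv (r : X → X) (x : SolSpace r) : SolSpace r :=
  ⟨fun n => x.1 (n + 1), fun n => x.2 (n + 1)⟩

/-- The shift `r̂ (x₀,x₁,…) = (r x₀, x₀, x₁, …)`. -/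
def shift (r : X → X) (x : SolSpace r) : SolSpace r :=
  ⟨fun n => Nat.rec (r (x.1 0)) (fun k _ => x.1 k) n, by
    intro n
    cases n with
    | zero => rfl
    | succ k => exact x.2 k⟩

/-- The σ-algebra `ℬ_∞` generated by `⋃ n, ℬ_n` where `ℬ_n = θ_n⁻¹(ℬ)`. -/
instance solMeasurableSpace (r : X → X) [MeasurableSpace X] :
    MeasurableSpace (SolSpace r) :=
  ⨆ n : ℕ, MeasurableSpace.comap (theta r n) inferInstance

/-- A function is bounded. -/
def IsBdd {α : Type*} (f : α → ℝ) : Prop := ∃ C : ℝ, ∀ x, |f x| ≤ C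

/-- The Ruelle transfer operator `R_V`. -/
noncomputable def ruelle (r : X → X) (hfin : ∀ x : X, (r ⁻¹' {x}).Finite)
    (V : X → ℝ) (f : X → ℝ) (x : X) : ℝ :=
  (∑ y ∈ (hfin x).toFinset, V y * f y) / ((hfin x).toFinset.card : ℝ)

/-- Strong `r`-invariance of a measure `ρ`. -/
def StronglyInvariant (r : X → X) (hfin : ∀ x : X, (r ⁻¹' {x}).Finite)
    [MeasurableSpace X] (ρ : Measure X) : Prop :=
  ∀ f : X → ℝ, Measurable f → IsBdd f →
    ∫ x, f x ∂ρ =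
      ∫ x, (∑ y ∈ (hfin x).toFinset, f y) / ((hfin x).toFinset.card : ℝ) ∂ρ

/-- The transformation of measures `T_V(μ) = (V dμ) ∘ r⁻¹`. -/
noncomputable def TV (r : X → X) [MeasurableSpace X] (V : X → ℝ) (μ : Measure X) :
    Measure X :=
  Measure.map r (μ.withDensity fun x => ENNReal.ofReal (V x))

/-- `V^{(n)} = V · (V∘r) ⋯ (V∘r^{n-1})`. -/
def Vpow (r : X → X) (V : X → ℝ) (n : ℕ) (x : X) : ℝ :=
  ∏ k ∈ Finset.range n, V (r^[k] x)

/-- Theorem 3.3 (necessity): if the extended measure `μ̂` is `V`-quasi-invariant, then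
`dμ₀ = (V dμ₀)∘r⁻¹` and `dμ_{n+1} = (V∘rⁿ) dμ_n`. -/
theorem stmt5 [MeasurableSpace X] [TopologicalSpace X] [CompactSpace X] [T2Space X]
    [BorelSpace X]
    (r : X → X) (hr : Continuous r) (hsurj : Function.Surjective r)
    (hfin : ∀ x : X, (r ⁻¹' {x}).Finite)
    (μs : ℕ → Measure X) (hfinite : ∀ n, IsFiniteMeasure (μs n))
    (hcons : ∀ n : ℕ, Measure.map r (μs (n + 1)) = μs n)
    (μhat : Measure (SolSpace r))
    (hproj : ∀ n : ℕ, Measure.map (theta r n) μhat = μs n)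
    (V : X → ℝ) (hV : Measurable V) (hVpos : ∀ x, 0 ≤ V x)
    (hqi : ∀ f : SolSpace r → ℝ, Measurable f → IsBdd f →
      ∫ x, f (shiftInv r x) ∂μhat = ∫ x, f x * V (theta r 0 x) ∂μhat) :
    ∀ f : X → ℝ, Measurable f → IsBdd f →
      (∫ x, f x ∂(μs 0) = ∫ x, f (r x) * V x ∂(μs 0)) ∧
      ∀ n : ℕ, ∫ x, f x ∂(μs (n + 1)) = ∫ x, f x * V (r^[n] x) ∂(μs n) := by
  have hth : ∀ n, Measurable (theta r n) := fun n =>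
    measurable_iff_comap_le.mpr (le_iSup
      (fun n : ℕ => MeasurableSpace.comap (theta r n) (inferInstance : MeasurableSpace X)) n)
  have hrm : Measurable r := hr.measurable
  have hit : ∀ (n : ℕ) (x : SolSpace r), r^[n] (theta r n x) = theta r 0 x := by
    intro n x
    induction n with
    | zero => rfl
    | succ k ih =>
      rw [Function.iterate_succ_apply, ← ih]
      exact congrArg _ (x.2 k)
  have key : ∀ (n : ℕ) (g : X → ℝ), Measurable g →
      ∫ x, g x ∂(μs n) = ∫ x, g (theta r n x) ∂μhat := by
    intro n g hg
    rw [← hproj n, integral_map (hth n).aemeasurable hg.aestronglyMeasurable]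
  intro f hf hb
  obtain ⟨C, hC⟩ := hb
  constructor
  · rw [key 0 f hf, key 0 (fun x => f (r x) * V x) ((hf.comp hrm).mul hV),
      ← hqi (fun x => f (r (theta r 0 x))) (hf.comp (hrm.comp (hth 0))) ⟨C, fun x => hC _⟩]
    refine integral_congr_ae (Filter.Eventually.of_forall fun x => ?_)
    exact congrArg f (x.2 0).symm
  · intro n
    rw [key (n + 1) f hf, key n (fun x => f x * V (r^[n] x)) (hf.mul (hV.comp (hrm.iterate n)))]
    simp only [hit]
    exact hqi (fun x => f (theta r n x)) (hf.comp (hth n)) ⟨C, fun x => hC _⟩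
end

section
/- Let (μ_n)_{n≥0} be a sequence of finite measures on (X, ℬ) with μ_{n+1}∘r^{-1} = μ_n for all n ≥ 0, let μ̂ be the unique measure on (X_∞(r), ℬ_∞) with μ̂∘θ_n^{-1} = μ_n, and let V : X → [0,∞) be measurable. If ∫_X f dμ₀ = ∫_X (f∘r)·V dμ₀ and ∫_X f dμ_{n+1} = ∫_X f·(V∘r^n) dμ_n for all bounded measurable f : X → ℝ and all n ≥ 0, then μ̂ is V-quasi-invariant, i.e., ∫ f∘r̂^{-1} dμ̂ = ∫ f·(V∘θ₀) dμ̂ for all bounded ℬ_∞-measurable f. -/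
open MeasureTheory Filter Topology Set

variable {X : Type*}

theorem theta_meas_aux [MeasurableSpace X] (r : X → X) (n : ℕ) : Measurable (theta r n) := by
  rw [measurable_iff_comap_le]
  exact le_iSup (fun n : ℕ => MeasurableSpace.comap (theta r n) inferInstance) n

theorem theta_iter_aux (r : X → X) (n : ℕ) (x : SolSpace r) :
    r^[n] (theta r n x) = theta r 0 x := by
  induction n with
  | zero => rfl
  | succ k ih =>
    rw [Function.iterate_succ_apply, ← ih]
    congr 1
    exact x.2 k

theorem shiftInv_meas_aux [MeasurableSpace X] (r : X → X) : Measurable (shiftInv r) := by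
  rw [measurable_iff_comap_le]
  show MeasurableSpace.comap (shiftInv r)
    (⨆ n : ℕ, MeasurableSpace.comap (theta r n) inferInstance) ≤ _
  rw [MeasurableSpace.comap_iSup]
  refine iSup_le fun n => ?_
  rw [MeasurableSpace.comap_comp, ← measurable_iff_comap_le]
  exact theta_meas_aux r (n + 1)

theorem comap_mono_aux [MeasurableSpace X] (r : X → X) (hr : Measurable r) :
    Monotone (fun n : ℕ => MeasurableSpace.comap (theta r n) (inferInstance : MeasurableSpace X)) := by
  refine monotone_nat_of_le_succ fun n => ?_
  have h : theta r n = r ∘ theta r (n + 1) := by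
    funext x
    exact (x.2 n).symm
  rw [h, ← MeasurableSpace.comap_comp]
  exact MeasurableSpace.comap_mono hr.comap_le

theorem ext_aux [MeasurableSpace X] (r : X → X) (hr : Measurable r)
    (ν₁ ν₂ : Measure (SolSpace r)) [IsFiniteMeasure ν₁]
    (h : ∀ (n : ℕ) (A : Set X), MeasurableSet A →
      ν₁ (theta r n ⁻¹' A) = ν₂ (theta r n ⁻¹' A)) : ν₁ = ν₂ := by
  refine ext_of_generate_finite
    (⋃ n : ℕ, {s | MeasurableSet[MeasurableSpace.comap (theta r n) inferInstance] s})
    (MeasurableSpace.generateFrom_iUnion_measurableSet _).symm ?_ ?_ ?_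
  · refine isPiSystem_iUnion_of_monotone _ (fun n => ?_) ?_
    · exact @MeasurableSpace.isPiSystem_measurableSet _
        (MeasurableSpace.comap (theta r n) inferInstance)
    · intro a b hab s hs
      exact comap_mono_aux r hr hab s hs
  · intro s hs
    obtain ⟨n, A, hA, rfl⟩ := mem_iUnion.1 hs
    exact h n A hA
  · simpa using h 0 univ MeasurableSet.univ

/-- Theorem 3.3 (sufficiency): if `dμ₀ = (V dμ₀)∘r⁻¹` and `dμ_{n+1} = (V∘rⁿ) dμ_n`, then
the extended measure `μ̂` is `V`-quasi-invariant. -/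
theorem stmt6 [MeasurableSpace X] [TopologicalSpace X] [CompactSpace X] [T2Space X]
    [BorelSpace X]
    (r : X → X) (hr : Continuous r) (hsurj : Function.Surjective r)
    (hfin : ∀ x : X, (r ⁻¹' {x}).Finite)
    (μs : ℕ → Measure X) (hfinite : ∀ n, IsFiniteMeasure (μs n))
    (hcons : ∀ n : ℕ, Measure.map r (μs (n + 1)) = μs n)
    (μhat : Measure (SolSpace r))
    (hproj : ∀ n : ℕ, Measure.map (theta r n) μhat = μs n)
    (V : X → ℝ) (hV : Measurable V) (hVpos : ∀ x, 0 ≤ V x)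
    (hfix : ∀ f : X → ℝ, Measurable f → IsBdd f →
      (∫ x, f x ∂(μs 0) = ∫ x, f (r x) * V x ∂(μs 0)) ∧
      ∀ n : ℕ, ∫ x, f x ∂(μs (n + 1)) = ∫ x, f x * V (r^[n] x) ∂(μs n)) :
    ∀ f : SolSpace r → ℝ, Measurable f → IsBdd f →
      ∫ x, f (shiftInv r x) ∂μhat = ∫ x, f x * V (theta r 0 x) ∂μhat := by
  have hrm : Measurable r := hr.measurable
  have hθ := theta_meas_aux r
  have hfin0 : IsFiniteMeasure μhat := by
    constructor
    have h := hproj 0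
    have h2 : μhat univ = μs 0 univ := by
      rw [← h, Measure.map_apply (hθ 0) MeasurableSet.univ, preimage_univ]
    rw [h2]
    exact measure_lt_top _ _
  have hVθ : Measurable fun x => V (theta r 0 x) := hV.comp (hθ 0)
  -- integrability of `V ∘ θ₀`
  have hint : Integrable (fun x => V (theta r 0 x)) μhat := by
    by_contra hni
    have h1 := (hfix (fun _ => 1) measurable_const ⟨1, fun x => by simp⟩).1
    have h2 : ∫ x, V x ∂(μs 0) = 0 := by
      rw [← hproj 0, integral_map (hθ 0).aemeasurable hV.aestronglyMeasurable]
      exact integral_undef hni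
    have h3 : (μs 0).real univ = 0 := by simpa [h2] using h1
    have h4 : μs 0 univ = 0 := by
      rcases (ENNReal.toReal_eq_zero_iff _).1 h3 with h | h
      · exact h
      · exact absurd h (measure_ne_top _ _)
    have h5 : μhat univ = 0 := by
      rw [← hproj 0, Measure.map_apply (hθ 0) MeasurableSet.univ, preimage_univ] at h4
      exact h4
    apply hni
    rw [Measure.measure_univ_eq_zero.1 h5]
    exact integrable_zero_measure
  have key : Measure.map (shiftInv r) μhat =
      μhat.withDensity fun x => ENNReal.ofReal (V (theta r 0 x)) := by
    refine ext_aux r hrm _ _ fun n A hA => ?_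
    have hS := hθ n hA
    rw [Measure.map_apply (shiftInv_meas_aux r) hS, withDensity_apply _ hS,
      ← ofReal_integral_eq_lintegral_ofReal hint.integrableOn
        (Eventually.of_forall fun x => hVpos _)]
    have e1 : shiftInv r ⁻¹' (theta r n ⁻¹' A) = theta r (n + 1) ⁻¹' A := rfl
    have h1 := (hfix (A.indicator fun _ => 1) (measurable_const.indicator hA)
      ⟨1, fun x => by by_cases hx : x ∈ A <;> simp [hx]⟩).2 n
    rw [integral_indicator_const _ hA] at h1
    have hm : Measurable fun x => A.indicator (fun _ => (1 : ℝ)) x * V (r^[n] x) :=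
      (measurable_const.indicator hA).mul (hV.comp (hrm.iterate n))
    rw [← hproj n, integral_map (hθ n).aemeasurable hm.aestronglyMeasurable] at h1
    rw [e1, ← Measure.map_apply (hθ (n + 1)) hA, hproj (n + 1),
      ← ENNReal.ofReal_toReal (measure_ne_top (μs (n + 1)) A)]
    congr 1
    have h2 : (μs (n + 1) A).toReal = (μs (n + 1)).real A • (1 : ℝ) := by
      simp [Measure.real]
    rw [h2, h1, ← integral_indicator hS]
    congr 1
    funext x
    rw [theta_iter_aux]
    by_cases hx : theta r n x ∈ A <;> simp [indicator, hx]
  intro f hf _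
  rw [← integral_map (shiftInv_meas_aux r).aemeasurable hf.aestronglyMeasurable, key,
    integral_withDensity_eq_integral_toReal_smul hVθ.ennreal_ofReal
      (Eventually.of_forall fun x => ENNReal.ofReal_lt_top)]
  congr 1
  funext x
  rw [ENNReal.toReal_ofReal (hVpos _), smul_eq_mul, mul_comm]
end

section
/- Let V : X → [0,∞) be bounded and measurable, and let μ₀ be a finite measure on (X, ℬ) with ∫_X f dμ₀ = ∫_X (f∘r)·V dμ₀ for all bounded measurable f. Define dμ_n := V^{(n)} dμ₀ for n ≥ 1 (and μ_0 := μ₀). Then μ_{n+1}∘r^{-1} = μ_n for all n ≥ 0, and μ_n(X) = ∫_X V^{(n)} dμ₀ = μ₀(X) for all n ≥ 1. -/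
open MeasureTheory Filter Topology Set

variable {X : Type*}

/-- Lemma 5.2: if `dμ₀ = (V dμ₀)∘r⁻¹` and `dμ_n := V⁽ⁿ⁾ dμ₀`, then
`μ_{n+1}∘r⁻¹ = μ_n` and `μ_n(X) = ∫ V⁽ⁿ⁾ dμ₀ = μ₀(X)` for all `n ≥ 1`. -/
theorem stmt8 [MeasurableSpace X] [TopologicalSpace X] [CompactSpace X] [T2Space X]
    [BorelSpace X]
    (r : X → X) (hr : Continuous r) (hsurj : Function.Surjective r)
    (hfin : ∀ x : X, (r ⁻¹' {x}).Finite)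
    (V : X → ℝ) (hV : Measurable V) (hVb : IsBdd V) (hVpos : ∀ x, 0 ≤ V x)
    (μ0 : Measure X) [IsFiniteMeasure μ0]
    (hfix : ∀ f : X → ℝ, Measurable f → IsBdd f →
      ∫ x, f x ∂μ0 = ∫ x, f (r x) * V x ∂μ0) :
    (∀ n : ℕ,
      Measure.map r (μ0.withDensity fun x => ENNReal.ofReal (Vpow r V (n + 1) x)) =
        μ0.withDensity fun x => ENNReal.ofReal (Vpow r V n x)) ∧
    ∀ n : ℕ, 1 ≤ n →
      (μ0.withDensity fun x => ENNReal.ofReal (Vpow r V n x)) Set.univ =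
          ENNReal.ofReal (∫ x, Vpow r V n x ∂μ0) ∧
      (μ0.withDensity fun x => ENNReal.ofReal (Vpow r V n x)) Set.univ = μ0 Set.univ := by
  have hrm : Measurable r := hr.measurable
  have hVm : ∀ n, Measurable (Vpow r V n) := by
    intro n
    unfold Vpow
    exact Finset.measurable_prod _ (fun k _ => hV.comp (hrm.iterate k))
  have hVp : ∀ n x, 0 ≤ Vpow r V n x := fun n x => Finset.prod_nonneg (fun k _ => hVpos _)
  obtain ⟨C, hC⟩ := hVb
  have hVB : ∀ n x, |Vpow r V n x| ≤ C ^ n := by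
    intro n x
    unfold Vpow
    rw [Finset.abs_prod]
    calc _ ≤ ∏ _k ∈ Finset.range n, C :=
          Finset.prod_le_prod (fun k _ => abs_nonneg _) (fun k _ => hC _)
      _ = C ^ n := by simp
  have hint : ∀ n, Integrable (Vpow r V n) μ0 := fun n =>
    Integrable.of_bound (hVm n).aestronglyMeasurable (C ^ n)
      (Eventually.of_forall (fun x => by rw [Real.norm_eq_abs]; exact hVB n x))
  have hset : ∀ n E, MeasurableSet E →
      (μ0.withDensity fun x => ENNReal.ofReal (Vpow r V n x)) E =
        ENNReal.ofReal (∫ x, E.indicator (Vpow r V n) x ∂μ0) := by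
    intro n E hE
    rw [withDensity_apply _ hE, integral_indicator hE,
      ofReal_integral_eq_lintegral_ofReal (hint n).integrableOn
        (Eventually.of_forall (hVp n))]
  have hsucc : ∀ n x, Vpow r V (n + 1) x = Vpow r V n (r x) * V x := by
    intro n x
    simp [Vpow, Finset.prod_range_succ']
  have h1 : ∀ n : ℕ,
      Measure.map r (μ0.withDensity fun x => ENNReal.ofReal (Vpow r V (n + 1) x)) =
        μ0.withDensity fun x => ENNReal.ofReal (Vpow r V n x) := by
    intro n
    ext E hE
    rw [Measure.map_apply hrm hE, hset _ _ (hrm hE), hset _ _ hE,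
      hfix (E.indicator (Vpow r V n)) ((hVm n).indicator hE)
        ⟨C ^ n, fun x => by
          rw [← Real.norm_eq_abs]
          exact (norm_indicator_le_norm_self _ x).trans (hVB n x)⟩]
    congr 2
    funext x
    by_cases hx : r x ∈ E
    · simp [Set.indicator, hx, hsucc]
    · simp [Set.indicator, hx]
  refine ⟨h1, fun n _ => ⟨?_, ?_⟩⟩
  · rw [hset n _ MeasurableSet.univ, Set.indicator_univ]
  · clear * - h1 hrm
    induction n with
    | zero => simp [Vpow]
    | succ k ih =>
      rw [← ih, ← h1 k, Measure.map_apply hrm MeasurableSet.univ, Set.preimage_univ]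
end

section
/- Let V : X → [0,∞) be continuous. Assume there exist a finite Borel measure ν on X and real numbers 0 < a < b such that a ≤ ν(X) ≤ b and a ≤ ∫_X V^{(n)} dν ≤ b for all n ≥ 1. Then there exists a finite Borel measure μ₀ on X with a ≤ μ₀(X) ≤ b satisfying ∫_X f dμ₀ = ∫_X (f∘r)·V dμ₀ for all bounded measurable f (i.e., T_V(μ₀) = μ₀), and consequently there exists a V-quasi-invariant measure μ̂ on (X_∞(r), ℬ_∞). -/
open MeasureTheory Filter Topology Set

variable {X : Type*}

namespace StmtAux

/-- Averaging along an ultrafilter: existence of an invariant positive functional. -/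
lemma exists_invariant_functional {K : Type*} [TopologicalSpace K] [CompactSpace K]
    (L : C(K, ℝ) →ₗ[ℝ] ℝ) (S : C(K, ℝ) →ₗ[ℝ] C(K, ℝ))
    (hL : ∀ f, 0 ≤ f → 0 ≤ L f) (hS : ∀ f, 0 ≤ f → 0 ≤ S f) (a b : ℝ)
    (h : ∀ n : ℕ, a ≤ L ((S ^ n) 1) ∧ L ((S ^ n) 1) ≤ b) :
    ∃ Λ : C(K, ℝ) →ₗ[ℝ] ℝ, (∀ f, 0 ≤ f → 0 ≤ Λ f) ∧ (∀ f, Λ (S f) = Λ f) ∧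
      a ≤ Λ 1 ∧ Λ 1 ≤ b := by
  have hSn : ∀ (n : ℕ) f, 0 ≤ f → 0 ≤ (S ^ n) f := by
    intro n
    induction n with
    | zero => intro f hf; simpa using hf
    | succ n ih =>
      intro f hf
      rw [pow_succ]
      exact ih _ (hS f hf)
  have hT : ∀ (n : ℕ) f, |L ((S ^ n) f)| ≤ b * ‖f‖ := by
    intro n f
    have h1 : 0 ≤ ‖f‖ • (1 : C(K, ℝ)) - f := by
      intro x
      have := (abs_le.1 (by simpa using f.norm_coe_le_norm x)).2
      simpa using this
    have h2 : 0 ≤ ‖f‖ • (1 : C(K, ℝ)) + f := by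
      intro x
      have := (abs_le.1 (by simpa using f.norm_coe_le_norm x)).1
      simp
      linarith
    have h1' := hL _ (hSn n _ h1)
    have h2' := hL _ (hSn n _ h2)
    simp only [map_sub, map_add, map_smul, smul_eq_mul] at h1' h2'
    have h3 := mul_le_mul_of_nonneg_left (h n).2 (norm_nonneg f)
    rw [abs_le]
    constructor <;> linarith
  let A : ℕ → C(K, ℝ) → ℝ := fun N f => (∑ n ∈ Finset.range (N + 1), L ((S ^ n) f)) / (N + 1)
  have hpos : ∀ N : ℕ, (0 : ℝ) < N + 1 := fun N => by positivity
  have hA : ∀ N f, A N f ∈ Icc (-(b * ‖f‖)) (b * ‖f‖) := by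
    intro N f
    refine abs_le.1 ?_
    simp only [A]
    rw [abs_div, abs_of_pos (hpos N), div_le_iff₀ (hpos N)]
    refine (Finset.abs_sum_le_sum_abs _ _).trans ?_
    refine (Finset.sum_le_sum (fun n _ => hT n f)).trans ?_
    simp
    linarith
  let U : Ultrafilter ℕ := hyperfilter ℕ
  have hlim : ∀ f, ∃ l, Tendsto (fun N => A N f) U (𝓝 l) := by
    intro f
    obtain ⟨l, -, hl⟩ := (isCompact_Icc (a := -(b * ‖f‖)) (b := b * ‖f‖)).ultrafilter_le_nhds
      (U.map (fun N => A N f)) (by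
        rw [le_principal_iff]
        exact Filter.mem_map.2 (Filter.univ_mem' (fun N => hA N f)))
    exact ⟨l, hl⟩
  choose l hl using hlim
  have hUle : (U : Filter ℕ) ≤ atTop := by
    rw [← Nat.cofinite_eq_atTop]
    exact hyperfilter_le_cofinite
  let Λ : C(K, ℝ) →ₗ[ℝ] ℝ :=
    { toFun := l
      map_add' := by
        intro f g
        refine tendsto_nhds_unique (hl (f + g)) (((hl f).add (hl g)).congr ?_)
        intro N
        simp only [A, map_add, Finset.sum_add_distrib, add_div]
      map_smul' := by
        intro c f
        refine tendsto_nhds_unique (hl (c • f)) (((hl f).const_mul c).congr ?_)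
        intro N
        simp only [A, map_smul, smul_eq_mul, ← Finset.mul_sum, mul_div_assoc] }
  refine ⟨Λ, ?_, ?_, ?_, ?_⟩
  · intro f hf
    refine ge_of_tendsto' (hl f) (fun N => ?_)
    exact div_nonneg (Finset.sum_nonneg (fun n _ => hL _ (hSn n f hf))) (hpos N).le
  · intro f
    have h0 : Tendsto (fun N => A N (S f) - A N f) atTop (𝓝 0) := by
      have hb : ∀ N : ℕ, |A N (S f) - A N f| ≤ (2 * (b * ‖f‖)) * (1 / ((N : ℝ) + 1)) := by
        intro N
        have e : A N (S f) - A N f = (L ((S ^ (N + 1)) f) - L ((S ^ 0) f)) / (N + 1) := by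
          simp only [A]
          rw [← sub_div, ← Finset.sum_sub_distrib,
            ← Finset.sum_range_sub (fun n => L ((S ^ n) f))]
          congr 1
        rw [e, abs_div, abs_of_pos (hpos N), div_eq_mul_one_div]
        refine mul_le_mul_of_nonneg_right ?_ (by positivity)
        have h1 := abs_le.1 (hT (N + 1) f)
        have h2 := abs_le.1 (hT 0 f)
        rw [abs_le]
        constructor <;> linarith
      refine squeeze_zero_norm hb ?_
      simpa using (tendsto_one_div_add_atTop_nhds_zero_nat (𝕜 := ℝ)).const_mul (2 * (b * ‖f‖))
    have h1 := (hl (S f)).sub (hl f)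
    have := tendsto_nhds_unique h1 (h0.mono_left hUle)
    exact sub_eq_zero.1 this
  · refine ge_of_tendsto' (hl 1) (fun N => ?_)
    simp only [A]
    rw [le_div_iff₀ (hpos N)]
    have := Finset.sum_le_sum (s := Finset.range (N + 1)) (fun n _ => (h n).1)
    simp at this
    linarith
  · refine le_of_tendsto' (hl 1) (fun N => ?_)
    simp only [A]
    rw [div_le_iff₀ (hpos N)]
    have := Finset.sum_le_sum (s := Finset.range (N + 1)) (fun n _ => (h n).2)
    simp at this
    linarith

/-- Regularity of a bounded-density measure. -/
lemma innerRegular_withDensity {K : Type*} [TopologicalSpace K] [CompactSpace K] [T2Space K]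
    [MeasurableSpace K] [BorelSpace K] (μ : Measure K) [IsFiniteMeasure μ] [μ.Regular]
    (w : K → ENNReal) (C : NNReal) (hw : ∀ x, w x ≤ C) :
    (μ.withDensity w).InnerRegular := by
  refine ⟨?_⟩
  intro A hA q hq
  have hle : ∀ B, MeasurableSet B → μ.withDensity w B ≤ C * μ B := by
    intro B hB
    rw [withDensity_apply _ hB]
    refine (lintegral_mono hw).trans ?_
    simp
  obtain ⟨ε, hε, hε'⟩ : ∃ ε : ENNReal, ε ≠ 0 ∧ q + C * ε < μ.withDensity w A := by
    obtain ⟨δ, hδ, hδ'⟩ := ENNReal.lt_iff_exists_add_pos_lt.1 hq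
    refine ⟨δ / (C + 1), ?_, ?_⟩
    · refine (ENNReal.div_pos (by exact_mod_cast hδ.ne') (by simp)).ne'
    · refine lt_of_le_of_lt ?_ hδ'
      gcongr
      rw [← mul_div_assoc]
      refine ENNReal.div_le_of_le_mul ?_
      rw [mul_comm]
      gcongr
      exact le_self_add
  obtain ⟨F, hFA, hF, hlt⟩ := hA.exists_isCompact_sdiff_lt (μ := μ) (measure_ne_top _ _) hε
  refine ⟨F, hFA, hF, ?_⟩
  have h1 : μ.withDensity w A ≤ μ.withDensity w F + C * ε := by
    calc μ.withDensity w A = μ.withDensity w (F ∪ A \ F) := by rw [union_sdiff_cancel hFA]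
      _ ≤ μ.withDensity w F + μ.withDensity w (A \ F) := measure_union_le _ _
      _ ≤ _ := by
        gcongr
        refine (hle _ (hA.diff hF.measurableSet)).trans ?_
        gcongr
  by_contra hcon
  push Not at hcon
  exact absurd (hε'.trans_le h1) (not_lt.2 (by gcongr))

lemma integral_TV {K : Type*} [MeasurableSpace K] (R : K → K) (hR : Measurable R)
    (W : K → ℝ) (hW : Measurable W) (hW0 : ∀ x, 0 ≤ W x) (μ : Measure K)
    (f : K → ℝ) (hf : Measurable f) :
    ∫ x, f x ∂(TV R W μ) = ∫ x, f (R x) * W x ∂μ := by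
  rw [TV, integral_map hR.aemeasurable hf.aestronglyMeasurable,
    integral_withDensity_eq_integral_toReal_smul hW.ennreal_ofReal (by simp)]
  refine integral_congr_ae (Eventually.of_forall fun x => ?_)
  simp [ENNReal.toReal_ofReal (hW0 x), mul_comm]

/-- Transfer operator on continuous functions. -/
def transfer {K : Type*} [TopologicalSpace K] (R W : C(K, K) × C(K, ℝ)) :
    C(K, ℝ) →ₗ[ℝ] C(K, ℝ) where
  toFun f := f.comp R.1 * W.2
  map_add' f g := by ext x; simp [add_mul]
  map_smul' c f := by ext x; simp

lemma exists_fixed {K : Type*} [TopologicalSpace K] [CompactSpace K] [T2Space K]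
    [MeasurableSpace K] [BorelSpace K] (R : K → K) (hR : Continuous R)
    (W : K → ℝ) (hW : Continuous W) (hW0 : ∀ x, 0 ≤ W x)
    (L : C(K, ℝ) →ₗ[ℝ] ℝ) (hL : ∀ f, 0 ≤ f → 0 ≤ L f) (a b : ℝ)
    (h : ∀ (n : ℕ) (g : C(K, ℝ)), (∀ x, g x = Vpow R W n x) → a ≤ L g ∧ L g ≤ b) :
    ∃ μ : Measure K, IsFiniteMeasure μ ∧ a ≤ (μ univ).toReal ∧ (μ univ).toReal ≤ b ∧
      TV R W μ = μ := by
  let RW : C(K, K) × C(K, ℝ) := (⟨R, hR⟩, ⟨W, hW⟩)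
  let S := transfer RW RW
  have hSapp : ∀ f x, S f x = f (R x) * W x := fun f x => rfl
  have hSn : ∀ (n : ℕ) x, ((S ^ n) 1) x = Vpow R W n x := by
    intro n
    induction n with
    | zero => intro x; simp [Vpow]
    | succ n ih =>
      intro x
      rw [pow_succ']
      change S ((S ^ n) 1) x = _
      rw [hSapp, ih, Vpow, Vpow, Finset.prod_range_succ']
      rfl
  obtain ⟨Λ, hΛ, hinv, ha, hb⟩ := exists_invariant_functional L S hL
    (fun f hf x => by
      change 0 ≤ S f x
      rw [hSapp]
      exact mul_nonneg (hf (R x)) (hW0 x)) a b (fun n => h n _ (hSn n))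
  let Λc : CompactlySupportedContinuousMap K ℝ →ₚ[ℝ] ℝ := PositiveLinearMap.mk₀
    { toFun := fun f => Λ f.toContinuousMap
      map_add' := fun f g => Λ.map_add f.toContinuousMap g.toContinuousMap
      map_smul' := fun c f => Λ.map_smul c f.toContinuousMap } (fun f hf => hΛ _ hf)
  let μ := RealRMK.rieszMeasure Λc
  have hint : ∀ f : C(K, ℝ), ∫ x, f x ∂μ = Λ f := fun f =>
    RealRMK.integral_rieszMeasure Λc (CompactlySupportedContinuousMap.continuousMapEquiv f)
  have hfin : IsFiniteMeasure μ := inferInstanceAs (IsFiniteMeasure (RealRMK.rieszMeasure Λc))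
  have hreg : μ.Regular := RealRMK.regular_rieszMeasure Λc
  have h1 : (μ univ).toReal = Λ 1 := by
    rw [← hint 1]
    simp [Measure.real]
  refine ⟨μ, hfin, h1 ▸ ha, h1 ▸ hb, ?_⟩
  have hbd : ∀ x, ENNReal.ofReal (W x) ≤ (‖RW.2‖₊ : NNReal) := by
    intro x
    refine ENNReal.ofReal_le_of_le_toReal ?_
    exact (le_abs_self _).trans (RW.2.norm_coe_le_norm x)
  have hir := innerRegular_withDensity μ (fun x => ENNReal.ofReal (W x)) _ hbd
  have hfd : IsFiniteMeasure (μ.withDensity fun x => ENNReal.ofReal (W x)) := by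
    refine isFiniteMeasure_withDensity ?_
    refine ((lintegral_mono hbd).trans_lt ?_).ne
    simp only [lintegral_const]
    exact ENNReal.mul_lt_top (by simp) (measure_lt_top _ _)
  have hir2 : (TV R W μ).InnerRegular := Measure.InnerRegular.map_of_continuous hR
  have hfd2 : IsFiniteMeasure (TV R W μ) := Measure.isFiniteMeasure_map _ _
  have hreg2 : (TV R W μ).Regular := inferInstance
  refine Measure.ext_of_integral_eq_on_compactlySupported (fun f => ?_)
  rw [integral_TV R hR.measurable W hW.measurable hW0 μ f f.continuous.measurable]
  exact (hint (S f.toContinuousMap)).trans ((hinv _).trans (hint f.toContinuousMap).symm)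

/-- The solenoid with its product topology and Borel σ-algebra. -/
def Sol (r : X → X) : Type _ := SolSpace r

/-- Coordinates on `Sol r`. -/
def thS (r : X → X) (n : ℕ) (x : Sol r) : X := theta r n x

instance [TopologicalSpace X] (r : X → X) : TopologicalSpace (Sol r) :=
  TopologicalSpace.induced (fun x : Sol r => fun n => thS r n x) inferInstance

instance [TopologicalSpace X] (r : X → X) : MeasurableSpace (Sol r) := borel _

instance [TopologicalSpace X] (r : X → X) : BorelSpace (Sol r) := ⟨rfl⟩

/-- The shift on `Sol r`. -/
def shiftS (r : X → X) (x : Sol r) : Sol r := shift r x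

/-- The identity map. -/
def toSolSpace (r : X → X) (x : Sol r) : SolSpace r := x

lemma isEmb [TopologicalSpace X] (r : X → X) :
    IsEmbedding (fun x : Sol r => fun n => thS r n x) :=
  ⟨⟨rfl⟩, fun _ _ h => Subtype.ext h⟩

instance [TopologicalSpace X] [T2Space X] (r : X → X) : T2Space (Sol r) := (isEmb r).t2Space

lemma cont_theta [TopologicalSpace X] (r : X → X) (n : ℕ) :
    Continuous (thS r n) :=
  (continuous_apply n).comp (isEmb r).continuous

lemma compactSol [TopologicalSpace X] [CompactSpace X] [T2Space X] (r : X → X)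
    (hr : Continuous r) : CompactSpace (Sol r) := by
  have hrange : range (fun x : Sol r => fun n => thS r n x) =
      {x : ℕ → X | ∀ n, r (x (n + 1)) = x n} := by
    ext y
    constructor
    · rintro ⟨x, rfl⟩
      exact x.2
    · intro hy
      exact ⟨⟨y, hy⟩, rfl⟩
  have hcl : IsClosed (range (fun x : Sol r => fun n => thS r n x)) := by
    rw [hrange, ofPred_forall]
    exact isClosed_iInter fun n =>
      isClosed_eq (hr.comp (continuous_apply _)) (continuous_apply _)
  exact (IsClosedEmbedding.mk (isEmb r) hcl).compactSpace

lemma cont_shift [TopologicalSpace X] (r : X → X) (hr : Continuous r) :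
    Continuous (shiftS r) := by
  rw [(isEmb r).continuous_iff]
  refine continuous_pi fun n => ?_
  cases n with
  | zero => exact hr.comp (cont_theta r 0)
  | succ k => exact cont_theta r k

lemma theta_surj (r : X → X) (hr : Function.Surjective r) :
    Function.Surjective (thS r 0) := by
  intro x
  choose s hs using hr
  refine ⟨⟨fun n => s^[n] x, fun n => ?_⟩, rfl⟩
  change r (s^[n + 1] x) = s^[n] x
  rw [Function.iterate_succ_apply', hs]

lemma measurable_theta [MeasurableSpace X] (r : X → X) (n : ℕ) : Measurable (theta r n) :=
  Measurable.of_comap_le (le_iSup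
    (fun n : ℕ => MeasurableSpace.comap (theta r n) (inferInstance : MeasurableSpace X)) n)

lemma measurable_to_sol [MeasurableSpace X] {Y : Type*} [MeasurableSpace Y] (r : X → X)
    (g : Y → SolSpace r) (hg : ∀ n, Measurable (fun y => theta r n (g y))) : Measurable g := by
  rw [measurable_iff_comap_le, solMeasurableSpace, MeasurableSpace.comap_iSup]
  refine iSup_le fun n => ?_
  rw [MeasurableSpace.comap_comp]
  exact (hg n).comap_le

/-- Lift of a positive functional along a surjection. -/
lemma exists_lift {K Y : Type*} [TopologicalSpace K] [CompactSpace K] [TopologicalSpace Y]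
    (p : C(K, Y)) (hp : Function.Surjective p) (l : C(Y, ℝ) →ₗ[ℝ] ℝ)
    (hl : ∀ f, 0 ≤ f → 0 ≤ l f) :
    ∃ L : C(K, ℝ) →ₗ[ℝ] ℝ, (∀ f, 0 ≤ f → 0 ≤ L f) ∧ ∀ g, L (g.comp p) = l g := by
  let e : C(Y, ℝ) →ₗ[ℝ] C(K, ℝ) :=
    { toFun := fun g => g.comp p
      map_add' := fun f g => rfl
      map_smul' := fun c f => rfl }
  have he : Function.Injective e := by
    intro f g hfg
    ext y
    obtain ⟨x, rfl⟩ := hp y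
    exact congrArg (fun h : C(K, ℝ) => h x) hfg
  let E := LinearEquiv.ofInjective e he
  let f : C(K, ℝ) →ₗ.[ℝ] ℝ := ⟨LinearMap.range e, l.comp E.symm.toLinearMap⟩
  have hfE : ∀ g, f (E g) = l g := fun g => congrArg l (E.symm_apply_apply g)
  obtain ⟨L, hL, hL0⟩ := riesz_extension (PointedCone.positive ℝ C(K, ℝ)) f
    (by
      intro x hx
      obtain ⟨g, rfl⟩ := E.surjective x
      rw [hfE]
      refine hl g fun y => ?_
      obtain ⟨x, rfl⟩ := hp y
      exact hx x)
    (by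
      intro y
      refine ⟨E (ContinuousMap.const _ ‖y‖), fun x => ?_⟩
      have := (abs_le.1 (by simpa using y.norm_coe_le_norm x)).1
      change 0 ≤ ‖y‖ + y x
      linarith)
  exact ⟨L, fun f hf => hL0 f hf, fun g => (hL (E g)).trans (hfE g)⟩

end StmtAux

open StmtAux in
/-- Theorem 6.4 (Markov–Kakutani): under the uniform bounds on `∫ V⁽ⁿ⁾ dν` there is a
fixed point `μ₀` of `T_V`, and hence a `V`-quasi-invariant measure `μ̂` on `X_∞(r)`. -/
theorem stmt11 [MeasurableSpace X] [TopologicalSpace X] [CompactSpace X] [T2Space X]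
    [BorelSpace X]
    (r : X → X) (hr : Continuous r) (hsurj : Function.Surjective r)
    (hfin : ∀ x : X, (r ⁻¹' {x}).Finite)
    (V : X → ℝ) (hV : Continuous V) (hVpos : ∀ x, 0 ≤ V x)
    (ν : Measure X) [IsFiniteMeasure ν] (a b : ℝ) (ha : 0 < a) (hab : a < b)
    (hν0 : a ≤ (ν Set.univ).toReal ∧ (ν Set.univ).toReal ≤ b)
    (hνn : ∀ n : ℕ, 1 ≤ n →
      a ≤ ∫ x, Vpow r V n x ∂ν ∧ ∫ x, Vpow r V n x ∂ν ≤ b) :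
    ∃ μ0 : Measure X, IsFiniteMeasure μ0 ∧
      a ≤ (μ0 Set.univ).toReal ∧ (μ0 Set.univ).toReal ≤ b ∧
      (∀ f : X → ℝ, Measurable f → IsBdd f →
        ∫ x, f x ∂μ0 = ∫ x, f (r x) * V x ∂μ0) ∧
      ∃ μhat : Measure (SolSpace r), IsFiniteMeasure μhat ∧
        Measure.map (theta r 0) μhat = μ0 ∧
        ∀ f : SolSpace r → ℝ, Measurable f → IsBdd f →
          ∫ x, f (shiftInv r x) ∂μhat = ∫ x, f x * V (theta r 0 x) ∂μhat := by
  have hc := compactSol r hr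
  let p : C(Sol r, X) := ⟨thS r 0, cont_theta r 0⟩
  have hintg : ∀ f : C(X, ℝ), Integrable f ν := fun f =>
    Integrable.of_bound f.continuous.measurable.aestronglyMeasurable ‖f‖
      (Eventually.of_forall fun x => f.norm_coe_le_norm x)
  let l : C(X, ℝ) →ₗ[ℝ] ℝ :=
    { toFun := fun f => ∫ x, f x ∂ν
      map_add' := fun f g => integral_add (hintg f) (hintg g)
      map_smul' := fun c f => integral_const_mul c _ }
  obtain ⟨L, hL, hLl⟩ := exists_lift p (theta_surj r hsurj) l
    (fun f hf => integral_nonneg hf)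
  have hVc : ∀ n, Continuous (Vpow r V n) := fun n =>
    continuous_finsetProd _ fun k _ => hV.comp (hr.iterate k)
  have hW : Continuous (fun x : Sol r => V (thS r 0 x)) := hV.comp (cont_theta r 0)
  have hiter : ∀ (k : ℕ) (x : Sol r),
      thS r 0 ((shiftS r)^[k] x) = r^[k] (thS r 0 x) := by
    intro k
    induction k with
    | zero => intro x; rfl
    | succ k ih =>
      intro x
      rw [Function.iterate_succ_apply, ih, Function.iterate_succ_apply]
      rfl
  obtain ⟨μ, hμf, hμa, hμb, hμ⟩ := exists_fixed (shiftS r)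
    (cont_shift r hr) (fun x : Sol r => V (thS r 0 x)) hW (fun x => hVpos _) L hL a b (by
      intro n g hg
      have : g = (⟨Vpow r V n, hVc n⟩ : C(X, ℝ)).comp p := by
        ext x
        rw [hg]
        simp only [Vpow, hiter]
        rfl
      rw [this, hLl]
      change a ≤ ∫ x, Vpow r V n x ∂ν ∧ ∫ x, Vpow r V n x ∂ν ≤ b
      rcases Nat.eq_zero_or_pos n with rfl | hn
      · simpa [Vpow, Measure.real] using hν0
      · exact hνn n hn)
  have key : ∀ f : Sol r → ℝ, Measurable f →
      ∫ x, f x ∂μ = ∫ x, f (shiftS r x) * V (thS r 0 x) ∂μ := by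
    intro f hf
    conv_lhs => rw [← hμ]
    exact integral_TV _ (cont_shift r hr).measurable _ hW.measurable (fun x => hVpos _) μ f hf
  let i : Sol r → SolSpace r := toSolSpace r
  have hi : Measurable i := measurable_to_sol r i fun n => (cont_theta r n).measurable
  have hth0 : Measurable (theta r 0) := measurable_theta r 0
  have hsi : Measurable (shiftInv r) :=
    measurable_to_sol r _ fun n => measurable_theta r (n + 1)
  have hmm : Measure.map (theta r 0) (Measure.map i μ) = Measure.map (theta r 0 ∘ i) μ :=
    Measure.map_map hth0 hi
  have hu : (Measure.map (theta r 0) (Measure.map i μ)) univ = μ univ := by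
    rw [hmm, Measure.map_apply (hth0.comp hi) MeasurableSet.univ, preimage_univ]
  refine ⟨Measure.map (theta r 0) (Measure.map i μ), ?_, by rwa [hu], by rwa [hu], ?_,
    Measure.map i μ, Measure.isFiniteMeasure_map _ _, rfl, ?_⟩
  · have := Measure.isFiniteMeasure_map μ i
    exact Measure.isFiniteMeasure_map _ _
  · intro f hf _
    have e1 := integral_map (μ := μ) (hth0.comp hi).aemeasurable hf.aestronglyMeasurable
    have e2 := integral_map (μ := μ) (f := fun x => f (r x) * V x) (hth0.comp hi).aemeasurable
        ((hf.comp hr.measurable).mul hV.measurable).aestronglyMeasurable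
    rw [hmm, e1, e2]
    exact key _ (hf.comp (hth0.comp hi))
  · intro f hf _
    have e1 := integral_map (μ := μ) (f := fun x => f (shiftInv r x)) hi.aemeasurable
      (hf.comp hsi).aestronglyMeasurable
    have e2 := integral_map (μ := μ) (f := fun x => f x * V (theta r 0 x)) hi.aemeasurable
        (hf.mul (hV.measurable.comp hth0)).aestronglyMeasurable
    rw [e1, e2]
    exact key _ ((hf.comp hsi).comp hi)
end

section
/- Let ρ be a strongly r-invariant probability measure on X and let V : X → [0,∞) be bounded and measurable. Then for every f ∈ L¹(X, ρ) with f ≥ 0, T_V(f dρ) = (R_V f) dρ, i.e., ∫_X (ξ∘r)·V·f dρ = ∫_X ξ·(R_V f) dρ for all bounded measurable ξ. Consequently, a finite measure μ₀ ≪ ρ with density h = dμ₀/dρ ∈ L¹(X, ρ) satisfies T_V(μ₀) = μ₀ if and only if R_V h = h (ρ-a.e.). -/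
open MeasureTheory Filter Topology Set

variable {X : Type*}

/-- The fibre average. -/
noncomputable def avg (r : X → X) (hfin : ∀ x : X, (r ⁻¹' {x}).Finite) (f : X → ℝ) (x : X) : ℝ :=
  (∑ y ∈ (hfin x).toFinset, f y) / ((hfin x).toFinset.card : ℝ)

lemma card_pos_fib (r : X → X) (hsurj : Function.Surjective r)
    (hfin : ∀ x : X, (r ⁻¹' {x}).Finite) (x : X) : (0 : ℝ) < ((hfin x).toFinset.card : ℝ) := by
  obtain ⟨y, hy⟩ := hsurj x
  have : 0 < (hfin x).toFinset.card := Finset.card_pos.mpr ⟨y, by simp [hy]⟩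
  exact_mod_cast this

lemma avg_nonneg (r : X → X) (hfin : ∀ x : X, (r ⁻¹' {x}).Finite) (f : X → ℝ)
    (hf : ∀ x, 0 ≤ f x) (x : X) : 0 ≤ avg r hfin f x :=
  div_nonneg (Finset.sum_nonneg fun y _ => hf y) (Nat.cast_nonneg _)

lemma avg_integrable [MeasurableSpace X] (r : X → X) (hsurj : Function.Surjective r)
    (hfin : ∀ x : X, (r ⁻¹' {x}).Finite)
    (ρ : Measure X) [IsProbabilityMeasure ρ] (hinv : StronglyInvariant r hfin ρ)
    (f : X → ℝ) (hf : Measurable f) (hfb : IsBdd f) : Integrable (avg r hfin f) ρ := by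
  by_contra hn
  have h0 : ∫ x, f x ∂ρ = 0 := by
    rw [hinv f hf hfb]; exact integral_undef hn
  have key : avg r hfin (fun x => f x + 1) = fun x => avg r hfin f x + 1 := by
    funext x
    have := card_pos_fib r hsurj hfin x
    simp only [avg, Finset.sum_add_distrib, Finset.sum_const, nsmul_eq_mul, mul_one]
    field_simp
  obtain ⟨C, hC⟩ := hfb
  have hb : IsBdd (fun x => f x + 1) :=
    ⟨C + 1, fun x => (abs_add_le _ _).trans (by simpa using hC x)⟩
  have h1 : ∫ x, (f x + 1) ∂ρ = 0 := by
    rw [hinv _ (hf.add_const 1) hb]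
    apply integral_undef
    intro h
    change Integrable (avg r hfin (fun x => f x + 1)) ρ at h
    rw [key] at h
    apply hn
    refine (h.sub (integrable_const (1 : ℝ))).congr (Eventually.of_forall fun x => ?_)
    simp
  have hfi : Integrable f ρ :=
    Integrable.of_bound hf.aestronglyMeasurable C (Eventually.of_forall hC)
  rw [integral_add hfi (integrable_const _), h0] at h1
  simp at h1

lemma lintegral_avg_bdd [MeasurableSpace X] (r : X → X) (hsurj : Function.Surjective r)
    (hfin : ∀ x : X, (r ⁻¹' {x}).Finite)
    (ρ : Measure X) [IsProbabilityMeasure ρ] (hinv : StronglyInvariant r hfin ρ)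
    (f : X → ℝ) (hf : Measurable f) (hfb : IsBdd f) (h0 : ∀ x, 0 ≤ f x) :
    ∫⁻ x, ENNReal.ofReal (f x) ∂ρ = ∫⁻ x, ENNReal.ofReal (avg r hfin f x) ∂ρ := by
  have hi := avg_integrable r hsurj hfin ρ hinv f hf hfb
  have hfi : Integrable f ρ := by
    obtain ⟨C, hC⟩ := hfb
    exact Integrable.of_bound hf.aestronglyMeasurable C (Eventually.of_forall hC)
  rw [← ofReal_integral_eq_lintegral_ofReal hfi (Eventually.of_forall h0),
    ← ofReal_integral_eq_lintegral_ofReal hi (Eventually.of_forall (avg_nonneg r hfin f h0)),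
    hinv f hf hfb]
  rfl

lemma avg_tendsto (r : X → X) (hfin : ∀ x : X, (r ⁻¹' {x}).Finite) (f : X → ℝ) (x : X) :
    Tendsto (fun n : ℕ => avg r hfin (fun y => min (f y) n) x) atTop (𝓝 (avg r hfin f x)) := by
  refine Tendsto.div_const (tendsto_finsetSum _ fun y _ => ?_) _
  refine tendsto_const_nhds.congr' ?_
  obtain ⟨N, hN⟩ := exists_nat_ge (f y)
  filter_upwards [eventually_ge_atTop N] with n hn
  exact (min_eq_left (hN.trans (by exact_mod_cast hn))).symm

lemma min_bdd (f : X → ℝ) (h0 : ∀ x, 0 ≤ f x) (n : ℕ) : IsBdd (fun y => min (f y) (n : ℝ)) :=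
  ⟨n, fun x => by rw [abs_of_nonneg (le_min (h0 x) (Nat.cast_nonneg n))]; exact min_le_right _ _⟩

lemma avg_aemeas [MeasurableSpace X] (r : X → X) (hsurj : Function.Surjective r)
    (hfin : ∀ x : X, (r ⁻¹' {x}).Finite)
    (ρ : Measure X) [IsProbabilityMeasure ρ] (hinv : StronglyInvariant r hfin ρ)
    (f : X → ℝ) (hf : Measurable f) (h0 : ∀ x, 0 ≤ f x) : AEMeasurable (avg r hfin f) ρ :=
  aemeasurable_of_tendsto_metrizable_ae atTop
    (fun n : ℕ => (avg_integrable r hsurj hfin ρ hinv _ (hf.min measurable_const)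
      (min_bdd f h0 n)).aemeasurable)
    (Eventually.of_forall fun x => avg_tendsto r hfin f x)

lemma lintegral_avg [MeasurableSpace X] (r : X → X) (hsurj : Function.Surjective r)
    (hfin : ∀ x : X, (r ⁻¹' {x}).Finite)
    (ρ : Measure X) [IsProbabilityMeasure ρ] (hinv : StronglyInvariant r hfin ρ)
    (f : X → ℝ) (hf : Measurable f) (h0 : ∀ x, 0 ≤ f x) :
    ∫⁻ x, ENNReal.ofReal (f x) ∂ρ = ∫⁻ x, ENNReal.ofReal (avg r hfin f x) ∂ρ := by
  have hm : ∀ n : ℕ, Measurable (fun y => min (f y) (n : ℝ)) := fun n => hf.min measurable_const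
  have t1 : Tendsto (fun n : ℕ => ∫⁻ x, ENNReal.ofReal (min (f x) n) ∂ρ) atTop
      (𝓝 (∫⁻ x, ENNReal.ofReal (f x) ∂ρ)) := by
    refine lintegral_tendsto_of_tendsto_of_monotone
      (fun n => (hm n).ennreal_ofReal.aemeasurable) ?_ ?_
    · refine Eventually.of_forall fun x m n hmn => ENNReal.ofReal_le_ofReal ?_
      exact min_le_min_left _ (by exact_mod_cast hmn)
    · refine Eventually.of_forall fun x => ENNReal.tendsto_ofReal ?_
      refine tendsto_const_nhds.congr' ?_
      obtain ⟨N, hN⟩ := exists_nat_ge (f x)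
      filter_upwards [eventually_ge_atTop N] with n hn
      exact (min_eq_left (hN.trans (by exact_mod_cast hn))).symm
  have t2 : Tendsto (fun n : ℕ => ∫⁻ x, ENNReal.ofReal (avg r hfin (fun y => min (f y) n) x) ∂ρ)
      atTop (𝓝 (∫⁻ x, ENNReal.ofReal (avg r hfin f x) ∂ρ)) := by
    refine lintegral_tendsto_of_tendsto_of_monotone
      (fun n => (avg_integrable r hsurj hfin ρ hinv _ (hm n)
        (min_bdd f h0 n)).aemeasurable.ennreal_ofReal) ?_ ?_
    · refine Eventually.of_forall fun x m n hmn => ENNReal.ofReal_le_ofReal ?_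
      refine div_le_div_of_nonneg_right (Finset.sum_le_sum fun y _ => ?_) (Nat.cast_nonneg _)
      exact min_le_min_left _ (by exact_mod_cast hmn)
    · exact Eventually.of_forall fun x => ENNReal.tendsto_ofReal (avg_tendsto r hfin f x)
  refine tendsto_nhds_unique t1 (t2.congr fun n => ?_)
  exact (lintegral_avg_bdd r hsurj hfin ρ hinv _ (hm n) (min_bdd f h0 n)
    (fun x => le_min (h0 x) (Nat.cast_nonneg n))).symm

lemma avg_congr [MeasurableSpace X] (r : X → X) (hsurj : Function.Surjective r)
    (hfin : ∀ x : X, (r ⁻¹' {x}).Finite)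
    (ρ : Measure X) [IsProbabilityMeasure ρ] (hinv : StronglyInvariant r hfin ρ)
    (f g : X → ℝ) (hfg : f =ᵐ[ρ] g) : avg r hfin f =ᵐ[ρ] avg r hfin g := by
  obtain ⟨N, hN, hNm, hN0⟩ := exists_measurable_superset_of_null (ae_iff.mp hfg)
  have hm : Measurable (N.indicator (fun _ => (1 : ℝ))) := measurable_const.indicator hNm
  have h0 : ∀ x, 0 ≤ N.indicator (fun _ => (1 : ℝ)) x :=
    fun x => indicator_nonneg (fun _ _ => zero_le_one) x
  have h := lintegral_avg r hsurj hfin ρ hinv _ hm h0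
  have hz : ∫⁻ x, ENNReal.ofReal (N.indicator (fun _ => (1 : ℝ)) x) ∂ρ = 0 := by
    rw [lintegral_eq_zero_iff hm.ennreal_ofReal]
    have : ∀ᵐ x ∂ρ, x ∉ N := measure_eq_zero_iff_ae_notMem.mp hN0
    filter_upwards [this] with x hx
    simp [hx]
  rw [hz, eq_comm, lintegral_eq_zero_iff'
    (avg_aemeas r hsurj hfin ρ hinv _ hm h0).ennreal_ofReal] at h
  filter_upwards [h] with x hx
  have hx' : avg r hfin (N.indicator (fun _ => (1 : ℝ))) x = 0 :=
    le_antisymm (ENNReal.ofReal_eq_zero.mp hx) (avg_nonneg r hfin _ h0 x)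
  have hs := (div_eq_zero_iff.mp hx').resolve_right (card_pos_fib r hsurj hfin x).ne'
  rw [Finset.sum_eq_zero_iff_of_nonneg fun y _ => h0 y] at hs
  unfold avg
  congr 1
  refine Finset.sum_congr rfl fun y hy => ?_
  by_contra hne
  have := hs y hy
  rw [indicator_of_mem (hN hne)] at this
  exact one_ne_zero this

lemma ruelle_main [MeasurableSpace X] (r : X → X) (hr : Measurable r)
    (hsurj : Function.Surjective r)
    (hfin : ∀ x : X, (r ⁻¹' {x}).Finite)
    (ρ : Measure X) [IsProbabilityMeasure ρ] (hinv : StronglyInvariant r hfin ρ)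
    (V : X → ℝ) (hV : Measurable V) (hVpos : ∀ x, 0 ≤ V x)
    (f : X → ℝ) (hf : AEMeasurable f ρ) (h0 : ∀ x, 0 ≤ f x) :
    AEMeasurable (ruelle r hfin V f) ρ ∧
    TV r V (ρ.withDensity fun x => ENNReal.ofReal (f x)) =
        ρ.withDensity fun x => ENNReal.ofReal (ruelle r hfin V f x) := by
  obtain ⟨g, hg, hg0, hfg⟩ : ∃ g : X → ℝ, Measurable g ∧ (∀ x, 0 ≤ g x) ∧ f =ᵐ[ρ] g := by
    refine ⟨fun x => max (hf.mk f x) 0, hf.measurable_mk.max measurable_const,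
      fun x => le_max_right _ _, ?_⟩
    filter_upwards [hf.ae_eq_mk] with x hx
    rw [← hx, max_eq_left (h0 x)]
  have hVg : Measurable fun x => V x * g x := hV.mul hg
  have hVg0 : ∀ x, 0 ≤ V x * g x := fun x => mul_nonneg (hVpos x) (hg0 x)
  have hR : ruelle r hfin V f =ᵐ[ρ] avg r hfin (fun x => V x * g x) :=
    avg_congr r hsurj hfin ρ hinv (fun x => V x * f x) _ (by
      filter_upwards [hfg] with x hx
      rw [hx])
  refine ⟨(avg_aemeas r hsurj hfin ρ hinv _ hVg hVg0).congr hR.symm, ?_⟩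
  have e1 : (ρ.withDensity fun x => ENNReal.ofReal (f x)) =
      ρ.withDensity fun x => ENNReal.ofReal (g x) :=
    withDensity_congr_ae (by filter_upwards [hfg] with x hx; rw [hx])
  have e2 : (ρ.withDensity fun x => ENNReal.ofReal (ruelle r hfin V f x)) =
      ρ.withDensity fun x => ENNReal.ofReal (avg r hfin (fun x => V x * g x) x) :=
    withDensity_congr_ae (by filter_upwards [hR] with x hx; rw [hx])
  rw [e1, e2, TV, ← withDensity_mul _ hg.ennreal_ofReal hV.ennreal_ofReal]
  ext A hA
  rw [Measure.map_apply hr hA, withDensity_apply _ (hr hA), withDensity_apply _ hA,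
    ← lintegral_indicator (hr hA), ← lintegral_indicator hA]
  have := lintegral_avg r hsurj hfin ρ hinv ((r ⁻¹' A).indicator fun x => V x * g x)
    (hVg.indicator (hr hA)) (fun x => indicator_nonneg (fun y _ => hVg0 y) x)
  convert this using 3 with x x
  · by_cases hx : x ∈ r ⁻¹' A
    · simp only [indicator_of_mem hx, Pi.mul_apply]
      rw [mul_comm, ← ENNReal.ofReal_mul (hVpos x)]
    · simp [indicator_of_notMem hx]
  · have hy : ∀ y ∈ (hfin x).toFinset, r y = x := fun y hy => by simpa using hy
    by_cases hx : x ∈ A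
    · rw [indicator_of_mem hx]
      unfold avg
      congr 2
      refine Finset.sum_congr rfl fun y hy' => ?_
      rw [indicator_of_mem]
      change r y ∈ A
      rwa [hy y hy']
    · rw [indicator_of_notMem hx]
      unfold avg
      rw [Finset.sum_eq_zero, zero_div, ENNReal.ofReal_zero]
      intro y hy'
      rw [indicator_of_notMem]
      change r y ∉ A
      rwa [hy y hy']

/-- Remark 6.5: `T_V(f dρ) = (R_V f) dρ` for `f ∈ L¹(ρ)`, `f ≥ 0`; consequently a finite
measure `μ₀ ≪ ρ` with density `h` satisfies `T_V(μ₀) = μ₀` iff `R_V h = h` (`ρ`-a.e.). -/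
theorem stmt12 [MeasurableSpace X] [TopologicalSpace X] [CompactSpace X] [T2Space X]
    [BorelSpace X]
    (r : X → X) (hr : Continuous r) (hsurj : Function.Surjective r)
    (hfin : ∀ x : X, (r ⁻¹' {x}).Finite)
    (ρ : Measure X) [IsProbabilityMeasure ρ] (hinv : StronglyInvariant r hfin ρ)
    (V : X → ℝ) (hV : Measurable V) (hVb : IsBdd V) (hVpos : ∀ x, 0 ≤ V x) :
    (∀ f : X → ℝ, Integrable f ρ → (∀ x, 0 ≤ f x) →
      (TV r V (ρ.withDensity fun x => ENNReal.ofReal (f x)) =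
        ρ.withDensity fun x => ENNReal.ofReal (ruelle r hfin V f x)) ∧
      ∀ ξ : X → ℝ, Measurable ξ → IsBdd ξ →
        ∫ x, ξ (r x) * V x * f x ∂ρ = ∫ x, ξ x * ruelle r hfin V f x ∂ρ) ∧
    ∀ μ0 : Measure X, IsFiniteMeasure μ0 → μ0 ≪ ρ →
      ∀ h : X → ℝ, Integrable h ρ → (∀ x, 0 ≤ h x) →
        μ0 = ρ.withDensity (fun x => ENNReal.ofReal (h x)) →
        (TV r V μ0 = μ0 ↔ (fun x => ruelle r hfin V h x) =ᵐ[ρ] h) := by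
  have hrm : Measurable r := hr.measurable
  have hRpos : ∀ f : X → ℝ, (∀ x, 0 ≤ f x) → ∀ x, 0 ≤ ruelle r hfin V f x :=
    fun f h0 x => avg_nonneg r hfin (fun y => V y * f y) (fun y => mul_nonneg (hVpos y) (h0 y)) x
  refine ⟨fun f hf h0 => ?_, fun μ0 _ _ h hh h0 hμ => ?_⟩
  · obtain ⟨hm, hT⟩ := ruelle_main r hrm hsurj hfin ρ hinv V hV hVpos f hf.aemeasurable h0
    refine ⟨hT, fun ξ hξ _ => ?_⟩
    have h1 : ∫ x, ξ x ∂(TV r V (ρ.withDensity fun x => ENNReal.ofReal (f x))) =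
        ∫ x, ξ (r x) * V x * f x ∂ρ := by
      rw [TV, integral_map hrm.aemeasurable hξ.aestronglyMeasurable,
        integral_withDensity_eq_integral_toReal_smul hV.ennreal_ofReal
          (Eventually.of_forall fun _ => ENNReal.ofReal_lt_top),
        integral_withDensity_eq_integral_toReal_smul₀ hf.aemeasurable.ennreal_ofReal
          (Eventually.of_forall fun _ => ENNReal.ofReal_lt_top)]
      refine integral_congr_ae (Eventually.of_forall fun x => ?_)
      simp only [smul_eq_mul, ENNReal.toReal_ofReal (h0 x), ENNReal.toReal_ofReal (hVpos x)]
      ring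
    rw [← h1, hT, integral_withDensity_eq_integral_toReal_smul₀ hm.ennreal_ofReal
          (Eventually.of_forall fun _ => ENNReal.ofReal_lt_top)]
    refine integral_congr_ae (Eventually.of_forall fun x => ?_)
    simp only [smul_eq_mul, ENNReal.toReal_ofReal (hRpos f h0 x)]
    ring
  · obtain ⟨hm, hT⟩ := ruelle_main r hrm hsurj hfin ρ hinv V hV hVpos h hh.aemeasurable h0
    rw [hμ, hT, eq_comm, withDensity_eq_iff hh.aemeasurable.ennreal_ofReal hm.ennreal_ofReal
      hh.lintegral_lt_top.ne]
    constructor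
    · intro H
      filter_upwards [H] with x hx
      exact ((ENNReal.ofReal_eq_ofReal_iff (h0 x) (hRpos h h0 x)).mp hx).symm
    · intro H
      filter_upwards [H] with x hx
      rw [← hx]
end

section
/- Let V : X → [0,∞) be measurable with (1/#r^{-1}(x)) ∑_{y : r(y)=x} V(y) ≤ 1 for all x ∈ X. Then the sequence R_V^n(𝟏) (the n-fold iterate of the Ruelle operator applied to the constant function one) is pointwise monotone decreasing: ⋯ ≤ R_V^{n+1}(𝟏) ≤ R_V^n(𝟏) ≤ ⋯ ≤ 𝟏 on X; hence the pointwise limit h_V := lim_{n→∞} R_V^n(𝟏) exists and satisfies R_V h_V = h_V. -/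
open MeasureTheory Filter Topology Set

variable {X : Type*}

/-- Theorem 6.7 (ii)–(iii): if `R_V 𝟏 ≤ 1` then `R_Vⁿ(𝟏)` is pointwise decreasing and
bounded by `1`, so the pointwise limit `h_V` exists and satisfies `R_V h_V = h_V`. -/
theorem stmt14 [MeasurableSpace X] [TopologicalSpace X] [CompactSpace X] [T2Space X]
    [BorelSpace X]
    (r : X → X) (hr : Continuous r) (hsurj : Function.Surjective r)
    (hfin : ∀ x : X, (r ⁻¹' {x}).Finite)
    (V : X → ℝ) (hV : Measurable V) (hVpos : ∀ x, 0 ≤ V x)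
    (hVsub : ∀ x, ruelle r hfin V (fun _ => 1) x ≤ 1) :
    (∀ (n : ℕ) (x : X),
      (ruelle r hfin V)^[n + 1] (fun _ => 1) x ≤ (ruelle r hfin V)^[n] (fun _ => 1) x) ∧
    (∀ (n : ℕ) (x : X), (ruelle r hfin V)^[n] (fun _ => 1) x ≤ 1) ∧
    ∃ hV' : X → ℝ,
      (∀ x, Tendsto (fun n => (ruelle r hfin V)^[n] (fun _ => 1) x) atTop (𝓝 (hV' x))) ∧
      ruelle r hfin V hV' = hV' := by
  have mono : ∀ f g : X → ℝ, (∀ x, f x ≤ g x) →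
      ∀ x, ruelle r hfin V f x ≤ ruelle r hfin V g x := by
    intro f g h x
    unfold ruelle
    apply div_le_div_of_nonneg_right _ (Nat.cast_nonneg _)
    exact Finset.sum_le_sum fun y _ => mul_le_mul_of_nonneg_left (h y) (hVpos y)
  have dec : ∀ (n : ℕ) (x : X),
      (ruelle r hfin V)^[n + 1] (fun _ => 1) x ≤ (ruelle r hfin V)^[n] (fun _ => 1) x := by
    intro n
    induction n with
    | zero => exact hVsub
    | succ k ih =>
      intro x
      rw [Function.iterate_succ_apply' _ (k + 1), Function.iterate_succ_apply' _ k]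
      simp only [Function.iterate_succ_apply'] at ih
      exact mono _ _ ih x
  have nonneg : ∀ (n : ℕ) (x : X), 0 ≤ (ruelle r hfin V)^[n] (fun _ => 1) x := by
    intro n
    induction n with
    | zero => intro x; simp
    | succ k ih =>
      intro x
      rw [Function.iterate_succ_apply']
      exact div_nonneg (Finset.sum_nonneg fun y _ => mul_nonneg (hVpos y) (ih y))
        (Nat.cast_nonneg _)
  have anti : ∀ x, Antitone (fun n => (ruelle r hfin V)^[n] (fun _ => 1) x) :=
    fun x => antitone_nat_of_succ_le fun n => dec n x
  have lim : ∀ x, Tendsto (fun n => (ruelle r hfin V)^[n] (fun _ => 1) x) atTop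
      (𝓝 (⨅ n, (ruelle r hfin V)^[n] (fun _ => 1) x)) := fun x =>
    tendsto_atTop_ciInf (anti x) ⟨0, by rintro _ ⟨n, rfl⟩; exact nonneg n x⟩
  refine ⟨dec, fun n x => anti x (Nat.zero_le n), _, lim, ?_⟩
  funext x
  refine tendsto_nhds_unique ?_ ((tendsto_add_atTop_iff_nat 1).2 (lim x))
  simp only [Function.iterate_succ_apply']
  unfold ruelle
  exact (tendsto_finsetSum _ fun y _ => (lim y).const_mul (V y)).div_const _
end

section
/- Let V, W : X → [0,∞) be measurable and suppose: (i) (1/#r^{-1}(x)) ∑_{y : r(y)=x} V(y)W(y) ≤ 1 for all x ∈ X; (ii) there exist a non-negative measurable function h_W on X and a finite measure ρ_W on X with ∫ R_W f dρ_W = ∫ f dρ_W for all bounded measurable f, R_W h_W = h_W, and ∫ h_W dρ_W = 1. Then T_V^n(f dρ_W) = (R_{VW}^n f) dρ_W for all bounded measurable f ≥ 0 and all n ≥ 1; moreover the pointwise limit h := lim_{n→∞} R_{VW}^n(𝟏) exists and satisfies T_V(h dρ_W) = h dρ_W. -/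
open MeasureTheory Filter Topology Set

variable {X : Type*}

section Helpers

variable {r : X → X} {hfin : ∀ x : X, (r ⁻¹' {x}).Finite}

lemma ruelle_nonneg {W f : X → ℝ} (hW : ∀ x, 0 ≤ W x) (hf : ∀ x, 0 ≤ f x) (x : X) :
    0 ≤ ruelle r hfin W f x := by
  unfold ruelle
  exact div_nonneg (Finset.sum_nonneg fun y _ => mul_nonneg (hW y) (hf y)) (Nat.cast_nonneg _)

lemma ruelle_mono {W f g : X → ℝ} (hW : ∀ x, 0 ≤ W x) (hfg : ∀ x, f x ≤ g x) (x : X) :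
    ruelle r hfin W f x ≤ ruelle r hfin W g x := by
  unfold ruelle
  refine div_le_div_of_nonneg_right ?_ (Nat.cast_nonneg _)
  exact Finset.sum_le_sum fun y _ => mul_le_mul_of_nonneg_left (hfg y) (hW y)

lemma ruelle_tendsto {W f : X → ℝ} {F : ℕ → X → ℝ}
    (h : ∀ x, Tendsto (fun n => F n x) atTop (𝓝 (f x))) (x : X) :
    Tendsto (fun n => ruelle r hfin W (F n) x) atTop (𝓝 (ruelle r hfin W f x)) := by
  unfold ruelle
  exact (tendsto_finsetSum _ fun y _ => (h y).const_mul _).div_const _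

lemma ruelle_add (W f g : X → ℝ) (x : X) :
    ruelle r hfin W (fun y => f y + g y) x = ruelle r hfin W f x + ruelle r hfin W g x := by
  unfold ruelle
  rw [← add_div, ← Finset.sum_add_distrib]
  simp only [mul_add]

variable [MeasurableSpace X]

lemma ruelle_integrable {W : X → ℝ} {ρ : Measure X} [IsFiniteMeasure ρ] (hρ0 : ρ ≠ 0)
    (hρ : ∀ f : X → ℝ, Measurable f → IsBdd f →
      ∫ x, ruelle r hfin W f x ∂ρ = ∫ x, f x ∂ρ)
    {f : X → ℝ} (hf : Measurable f) (hb : IsBdd f) :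
    Integrable (fun x => ruelle r hfin W f x) ρ := by
  have key : ∀ g : X → ℝ, Measurable g → IsBdd g → ∫ x, g x ∂ρ ≠ 0 →
      Integrable (fun x => ruelle r hfin W g x) ρ := by
    intro g hg hgb h0
    by_contra hni
    exact h0 (by rw [← hρ g hg hgb, integral_undef hni])
  have hone : ∫ _x : X, (1 : ℝ) ∂ρ ≠ 0 := by
    simp [Measure.real, ENNReal.toReal_eq_zero_iff, hρ0]
  by_cases h0 : ∫ x, f x ∂ρ = 0
  · have h1 := key (fun _ => 1) measurable_const ⟨1, by simp⟩ hone
    obtain ⟨C, hC⟩ := hb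
    have hfi : Integrable f ρ :=
      Integrable.of_bound hf.aestronglyMeasurable C (Eventually.of_forall hC)
    have h2 := key (fun x => f x + 1) (hf.add_const 1)
      ⟨C + 1, fun x => (abs_add_le _ _).trans (by simpa using hC x)⟩
      (by rw [integral_add hfi (integrable_const _), h0, zero_add]; exact hone)
    refine (h2.sub h1).congr (Eventually.of_forall fun x => ?_)
    simp [ruelle_add]
  · exact key f hf hb h0

lemma ruelle_lintegral_meas {W : X → ℝ} {ρ : Measure X} [IsFiniteMeasure ρ] (hρ0 : ρ ≠ 0)
    (hW : ∀ x, 0 ≤ W x)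
    (hρ : ∀ f : X → ℝ, Measurable f → IsBdd f →
      ∫ x, ruelle r hfin W f x ∂ρ = ∫ x, f x ∂ρ)
    {f : X → ℝ} (hf : Measurable f) (h0 : ∀ x, 0 ≤ f x) :
    AEMeasurable (fun x => ruelle r hfin W f x) ρ ∧
    ∫⁻ x, ENNReal.ofReal (ruelle r hfin W f x) ∂ρ = ∫⁻ x, ENNReal.ofReal (f x) ∂ρ := by
  set F : ℕ → X → ℝ := fun n x => min (f x) n with hF
  have Fm : ∀ n, Measurable (F n) := fun n => hf.min measurable_const
  have F0 : ∀ n x, 0 ≤ F n x := fun n x => le_min (h0 x) (Nat.cast_nonneg _)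
  have Fb : ∀ n, IsBdd (F n) := fun n =>
    ⟨n, fun x => by rw [abs_of_nonneg (F0 n x)]; exact min_le_right _ _⟩
  have Fmono : ∀ x, Monotone fun n => F n x := fun x m n hmn =>
    min_le_min le_rfl (Nat.cast_le.2 hmn)
  have Ft : ∀ x, Tendsto (fun n => F n x) atTop (𝓝 (f x)) := by
    intro x
    obtain ⟨N, hN⟩ := exists_nat_ge (f x)
    refine tendsto_const_nhds.congr' ?_
    filter_upwards [eventually_ge_atTop N] with n hn
    exact (min_eq_left (hN.trans (Nat.cast_le.2 hn))).symm
  have Ri := fun n => ruelle_integrable (r := r) (hfin := hfin) hρ0 hρ (Fm n) (Fb n)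
  have Rt := fun x => ruelle_tendsto (r := r) (hfin := hfin) (W := W) Ft x
  refine ⟨aemeasurable_of_tendsto_metrizable_ae atTop (fun n => (Ri n).aemeasurable)
    (Eventually.of_forall Rt), ?_⟩
  have e : ∀ n, ∫⁻ x, ENNReal.ofReal (ruelle r hfin W (F n) x) ∂ρ =
      ∫⁻ x, ENNReal.ofReal (F n x) ∂ρ := by
    intro n
    have hi : Integrable (F n) ρ := by
      obtain ⟨C, hC⟩ := Fb n
      exact Integrable.of_bound (Fm n).aestronglyMeasurable C (Eventually.of_forall hC)
    rw [← ofReal_integral_eq_lintegral_ofReal (Ri n)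
      (Eventually.of_forall (ruelle_nonneg hW (F0 n))),
      ← ofReal_integral_eq_lintegral_ofReal hi (Eventually.of_forall (F0 n)),
      hρ _ (Fm n) (Fb n)]
  have t1 := lintegral_tendsto_of_tendsto_of_monotone (μ := ρ)
    (f := fun n x => ENNReal.ofReal (ruelle r hfin W (F n) x))
    (F := fun x => ENNReal.ofReal (ruelle r hfin W f x))
    (fun n => (Ri n).aemeasurable.ennreal_ofReal)
    (Eventually.of_forall fun x m n hmn =>
      ENNReal.ofReal_le_ofReal (ruelle_mono hW (fun y => Fmono y hmn) x))
    (Eventually.of_forall fun x => ENNReal.tendsto_ofReal (Rt x))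
  have t2 := lintegral_tendsto_of_tendsto_of_monotone (μ := ρ)
    (f := fun n x => ENNReal.ofReal (F n x))
    (F := fun x => ENNReal.ofReal (f x))
    (fun n => (Fm n).ennreal_ofReal.aemeasurable)
    (Eventually.of_forall fun x m n hmn => ENNReal.ofReal_le_ofReal (Fmono x hmn))
    (Eventually.of_forall fun x => ENNReal.tendsto_ofReal (Ft x))
  simp only [e] at t1
  exact tendsto_nhds_unique t1 t2

lemma ruelle_congr_ae {W : X → ℝ} {ρ : Measure X} [IsFiniteMeasure ρ] (hρ0 : ρ ≠ 0)
    (hW : ∀ x, 0 ≤ W x)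
    (hρ : ∀ f : X → ℝ, Measurable f → IsBdd f →
      ∫ x, ruelle r hfin W f x ∂ρ = ∫ x, f x ∂ρ)
    {f g : X → ℝ} (hfg : f =ᵐ[ρ] g) :
    (fun x => ruelle r hfin W f x) =ᵐ[ρ] fun x => ruelle r hfin W g x := by
  set N := toMeasurable ρ {x | ¬ f x = g x} with hN
  have Nm : MeasurableSet N := measurableSet_toMeasurable _ _
  have N0 : ρ N = 0 := by rw [hN, measure_toMeasurable]; exact hfg
  set φ : X → ℝ := N.indicator fun _ => 1 with hφ
  have φ0 : ∀ x, 0 ≤ φ x := fun x => indicator_nonneg (fun _ _ => zero_le_one) x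
  obtain ⟨hm, hl⟩ := ruelle_lintegral_meas (r := r) (hfin := hfin) hρ0 hW hρ
    (measurable_const.indicator Nm : Measurable φ) φ0
  have hz : ∫⁻ x, ENNReal.ofReal (φ x) ∂ρ = 0 := by
    rw [lintegral_eq_zero_iff' (measurable_const.indicator Nm).ennreal_ofReal.aemeasurable]
    filter_upwards [measure_eq_zero_iff_ae_notMem.1 N0] with x hx
    simp [hφ, hx]
  rw [hz, lintegral_eq_zero_iff' hm.ennreal_ofReal] at hl
  filter_upwards [hl] with x hx
  have hx' : ruelle r hfin W φ x = 0 :=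
    le_antisymm (ENNReal.ofReal_eq_zero.1 hx) (ruelle_nonneg hW φ0 x)
  unfold ruelle at hx' ⊢
  congr 1
  refine Finset.sum_congr rfl fun y hy => ?_
  have hc : (((hfin x).toFinset.card : ℕ) : ℝ) ≠ 0 :=
    Nat.cast_ne_zero.2 (Finset.card_ne_zero_of_mem hy)
  have hs := (div_eq_zero_iff.1 hx').resolve_right hc
  have hy0 := (Finset.sum_eq_zero_iff_of_nonneg
    (fun y _ => mul_nonneg (hW y) (φ0 y))).1 hs y hy
  by_cases hyN : y ∈ N
  · have : W y = 0 := by simpa [hφ, hyN] using hy0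
    simp [this]
  · have : f y = g y := by
      by_contra hne
      exact hyN (subset_toMeasurable ρ _ hne)
    rw [this]

lemma ruelle_lintegral {W : X → ℝ} {ρ : Measure X} [IsFiniteMeasure ρ] (hρ0 : ρ ≠ 0)
    (hW : ∀ x, 0 ≤ W x)
    (hρ : ∀ f : X → ℝ, Measurable f → IsBdd f →
      ∫ x, ruelle r hfin W f x ∂ρ = ∫ x, f x ∂ρ)
    {f : X → ℝ} (hf : AEMeasurable f ρ) (h0 : ∀ x, 0 ≤ f x) :
    AEMeasurable (fun x => ruelle r hfin W f x) ρ ∧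
    ∫⁻ x, ENNReal.ofReal (ruelle r hfin W f x) ∂ρ = ∫⁻ x, ENNReal.ofReal (f x) ∂ρ := by
  have hfg : f =ᵐ[ρ] fun x => max (hf.mk f x) 0 := by
    filter_upwards [hf.ae_eq_mk] with x hx
    rw [← hx, max_eq_left (h0 x)]
  obtain ⟨hm, hl⟩ := ruelle_lintegral_meas (r := r) (hfin := hfin) hρ0 hW hρ
    (hf.measurable_mk.max measurable_const : Measurable fun x => max (hf.mk f x) 0)
    (fun x => le_max_right _ _)
  have hc := ruelle_congr_ae (r := r) (hfin := hfin) hρ0 hW hρ hfg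
  refine ⟨hm.congr hc.symm, ?_⟩
  exact (lintegral_congr_ae (hc.fun_comp ENNReal.ofReal)).trans
    (hl.trans (lintegral_congr_ae (hfg.fun_comp ENNReal.ofReal)).symm)

lemma ruelle_mul_eq (V W f : X → ℝ) :
    ruelle r hfin (fun y => V y * W y) f = ruelle r hfin W (fun y => V y * f y) := by
  funext x
  unfold ruelle
  congr 1
  exact Finset.sum_congr rfl fun y _ => by ring

lemma TV_withDensity {V W : X → ℝ} {ρ : Measure X} [IsFiniteMeasure ρ] (hρ0 : ρ ≠ 0)
    (hr : Measurable r) (hV : Measurable V) (hVpos : ∀ x, 0 ≤ V x) (hW : ∀ x, 0 ≤ W x)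
    (hρ : ∀ f : X → ℝ, Measurable f → IsBdd f →
      ∫ x, ruelle r hfin W f x ∂ρ = ∫ x, f x ∂ρ)
    {f : X → ℝ} (hf : AEMeasurable f ρ) (h0 : ∀ x, 0 ≤ f x) :
    AEMeasurable (ruelle r hfin (fun y => V y * W y) f) ρ ∧
    TV r V (ρ.withDensity fun x => ENNReal.ofReal (f x)) =
      ρ.withDensity fun x => ENNReal.ofReal (ruelle r hfin (fun y => V y * W y) f x) := by
  have gm : AEMeasurable (fun y => V y * f y) ρ := hV.aemeasurable.mul hf
  have g0 : ∀ y, 0 ≤ V y * f y := fun y => mul_nonneg (hVpos y) (h0 y)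
  rw [ruelle_mul_eq]
  refine ⟨(ruelle_lintegral (r := r) (hfin := hfin) hρ0 hW hρ gm g0).1, ?_⟩
  ext S hS
  have hS' := hr hS
  unfold TV
  rw [Measure.map_apply hr hS, ← withDensity_mul₀ hf.ennreal_ofReal
    hV.ennreal_ofReal.aemeasurable, withDensity_apply _ hS', withDensity_apply _ hS,
    ← lintegral_indicator hS', ← lintegral_indicator hS]
  have h := (ruelle_lintegral (r := r) (hfin := hfin) hρ0 hW hρ (gm.indicator hS')
    (fun x => indicator_nonneg (fun y _ => g0 y) x)).2
  calc _ = ∫⁻ x, ENNReal.ofReal ((r ⁻¹' S).indicator (fun y => V y * f y) x) ∂ρ := by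
        refine lintegral_congr fun x => ?_
        by_cases hx : x ∈ r ⁻¹' S
        · simp only [indicator_of_mem hx, Pi.mul_apply]
          rw [mul_comm, ENNReal.ofReal_mul (hVpos x)]
        · simp only [indicator_of_notMem hx, ENNReal.ofReal_zero]
    _ = _ := h.symm
    _ = _ := by
        refine lintegral_congr fun x => ?_
        have hy : ∀ y ∈ (hfin x).toFinset, r y = x := fun y hy => by simpa using hy
        by_cases hx : x ∈ S
        · rw [indicator_of_mem hx]
          unfold ruelle
          congr 2
          refine Finset.sum_congr rfl fun y hyx => ?_
          rw [indicator_of_mem (show y ∈ r ⁻¹' S by rw [mem_preimage, hy y hyx]; exact hx)]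
        · rw [indicator_of_notMem hx]
          unfold ruelle
          rw [Finset.sum_eq_zero, zero_div, ENNReal.ofReal_zero]
          intro y hyx
          rw [indicator_of_notMem (show y ∉ r ⁻¹' S by rw [mem_preimage, hy y hyx]; exact hx),
            mul_zero]

end Helpers

/-- Corollary 6.8: under the hypotheses on `V, W, h_W, ρ_W`,
`T_Vⁿ(f dρ_W) = (R_{VW}ⁿ f) dρ_W`, and the pointwise limit `h = lim R_{VW}ⁿ(𝟏)` exists
and satisfies `T_V(h dρ_W) = h dρ_W`. -/
theorem stmt16 [MeasurableSpace X] [TopologicalSpace X] [CompactSpace X] [T2Space X]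
    [BorelSpace X]
    (r : X → X) (hr : Continuous r) (hsurj : Function.Surjective r)
    (hfin : ∀ x : X, (r ⁻¹' {x}).Finite)
    (V W : X → ℝ) (hV : Measurable V) (hW : Measurable W)
    (hVpos : ∀ x, 0 ≤ V x) (hWpos : ∀ x, 0 ≤ W x)
    (hsub : ∀ x, ruelle r hfin (fun y => V y * W y) (fun _ => 1) x ≤ 1)
    (hW' : X → ℝ) (hW'meas : Measurable hW') (hW'pos : ∀ x, 0 ≤ hW' x)
    (ρW : Measure X) [IsFiniteMeasure ρW]
    (hρW : ∀ f : X → ℝ, Measurable f → IsBdd f →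
      ∫ x, ruelle r hfin W f x ∂ρW = ∫ x, f x ∂ρW)
    (hWfix : ruelle r hfin W hW' = hW')
    (hnorm : ∫ x, hW' x ∂ρW = 1) :
    (∀ n : ℕ, 1 ≤ n → ∀ f : X → ℝ, Measurable f → IsBdd f → (∀ x, 0 ≤ f x) →
      (TV r V)^[n] (ρW.withDensity fun x => ENNReal.ofReal (f x)) =
        ρW.withDensity fun x =>
          ENNReal.ofReal ((ruelle r hfin (fun y => V y * W y))^[n] f x)) ∧
    ∃ h : X → ℝ,
      (∀ x, Tendsto
        (fun n => (ruelle r hfin (fun y => V y * W y))^[n] (fun _ => 1) x)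
        atTop (𝓝 (h x))) ∧
      TV r V (ρW.withDensity fun x => ENNReal.ofReal (h x)) =
        ρW.withDensity fun x => ENNReal.ofReal (h x) := by
  have hρ0 : ρW ≠ 0 := by
    rintro rfl
    simp at hnorm
  have hVW : ∀ x, 0 ≤ V x * W x := fun x => mul_nonneg (hVpos x) (hWpos x)
  have main : ∀ f : X → ℝ, AEMeasurable f ρW → (∀ x, 0 ≤ f x) → ∀ n : ℕ,
      AEMeasurable ((ruelle r hfin (fun y => V y * W y))^[n] f) ρW ∧
      (∀ x, 0 ≤ (ruelle r hfin (fun y => V y * W y))^[n] f x) ∧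
      (TV r V)^[n] (ρW.withDensity fun x => ENNReal.ofReal (f x)) =
        ρW.withDensity fun x =>
          ENNReal.ofReal ((ruelle r hfin (fun y => V y * W y))^[n] f x) := by
    intro f hf h0 n
    induction n with
    | zero => exact ⟨hf, h0, rfl⟩
    | succ n ih =>
      obtain ⟨a, b, c⟩ := ih
      obtain ⟨d, e⟩ := TV_withDensity (r := r) (hfin := hfin) hρ0 hr.measurable hV hVpos
        hWpos hρW a b
      simp only [Function.iterate_succ_apply']
      exact ⟨d, ruelle_nonneg hVW b, by rw [c, e]⟩
  refine ⟨fun n _ f hf _ h0 => (main f hf.aemeasurable h0 n).2.2, ?_⟩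
  have m1 := main (fun _ => 1) aemeasurable_const (fun _ => zero_le_one)
  have anti : ∀ x, Antitone
      fun n => (ruelle r hfin (fun y => V y * W y))^[n] (fun _ => 1) x := by
    have step : ∀ n x, (ruelle r hfin (fun y => V y * W y))^[n + 1] (fun _ => 1) x ≤
        (ruelle r hfin (fun y => V y * W y))^[n] (fun _ => 1) x := by
      intro n
      induction n with
      | zero => exact hsub
      | succ n ih =>
        intro x
        rw [Function.iterate_succ_apply' _ (n + 1), Function.iterate_succ_apply' _ n (fun _ => 1)]
        have ih' := ih
        simp only [Function.iterate_succ_apply'] at ih' ⊢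
        exact ruelle_mono hVW ih' x
    exact fun x => antitone_nat_of_succ_le fun n => step n x
  have lim : ∀ x, Tendsto
      (fun n => (ruelle r hfin (fun y => V y * W y))^[n] (fun _ => 1) x) atTop
      (𝓝 (⨅ n, (ruelle r hfin (fun y => V y * W y))^[n] (fun _ => 1) x)) := fun x =>
    tendsto_atTop_ciInf (anti x) ⟨0, by rintro _ ⟨n, rfl⟩; exact (m1 n).2.1 x⟩
  refine ⟨_, lim, ?_⟩
  set h : X → ℝ := fun x => ⨅ n, (ruelle r hfin (fun y => V y * W y))^[n] (fun _ => 1) x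
    with hh
  have hm : AEMeasurable h ρW := aemeasurable_of_tendsto_metrizable_ae atTop
    (fun n => (m1 n).1) (Eventually.of_forall lim)
  have h0 : ∀ x, 0 ≤ h x := fun x => ge_of_tendsto' (lim x) fun n => (m1 n).2.1 x
  have hfix : ruelle r hfin (fun y => V y * W y) h = h := by
    funext x
    refine tendsto_nhds_unique (ruelle_tendsto lim x) ?_
    have := (tendsto_add_atTop_iff_nat 1).2 (lim x)
    simpa only [Function.iterate_succ_apply'] using this
  have := (TV_withDensity (r := r) (hfin := hfin) hρ0 hr.measurable hV hVpos
        hWpos hρW hm h0).2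
  rw [hfix] at this
  exact this
end

section
/- Let V : X → [0,∞) be bounded and measurable, and let μ̂ be a V-quasi-invariant probability measure on (X_∞(r), ℬ_∞). Then μ̂ is an extreme point of the convex set M_{qi,1}^V(X_∞(r)) of all V-quasi-invariant probability measures on (X_∞(r), ℬ_∞) if and only if the measure (V∘θ₀) dμ̂ is ergodic with respect to r̂, i.e., every set A ∈ ℬ_∞ with r̂(A) = A satisfies ∫_A V∘θ₀ dμ̂ = 0 or ∫_{X_∞(r)∖A} V∘θ₀ dμ̂ = 0. (Extreme point means: whenever μ̂ = λμ̂₁ + (1−λ)μ̂₂ with μ̂₁, μ̂₂ ∈ M_{qi,1}^V(X_∞(r)) and λ ∈ (0,1), then μ̂₁ = μ̂₂ = μ̂.) -/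
open MeasureTheory Filter Topology Set

variable {X : Type*}

section Helpers

open scoped ENNReal

lemma measurable_theta (r : X → X) [MeasurableSpace X] (n : ℕ) : Measurable (theta r n) := by
  rw [measurable_iff_comap_le]
  exact le_iSup (fun n : ℕ => MeasurableSpace.comap (theta r n) inferInstance) n

lemma measurable_to_sol (r : X → X) [MeasurableSpace X] {α : Type*} [MeasurableSpace α]
    (f : α → SolSpace r) (h : ∀ n, Measurable fun a => theta r n (f a)) : Measurable f := by
  rw [measurable_iff_le_map]
  refine iSup_le fun n => ?_
  rw [← measurable_iff_le_map]
  rintro _ ⟨s, hs, rfl⟩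
  exact h n hs

lemma measurable_shiftInv (r : X → X) [MeasurableSpace X] : Measurable (shiftInv r) :=
  measurable_to_sol r _ fun n => measurable_theta r (n + 1)

lemma measurable_shift (r : X → X) [MeasurableSpace X] (hr : Measurable r) :
    Measurable (shift r) := by
  refine measurable_to_sol r _ fun n => ?_
  cases n with
  | zero => exact hr.comp (measurable_theta r 0)
  | succ k => exact measurable_theta r k

lemma shift_shiftInv (r : X → X) (x : SolSpace r) : shift r (shiftInv r x) = x := by
  apply Subtype.ext
  funext n
  cases n with
  | zero => exact x.2 0
  | succ k => rfl

lemma shiftInv_shift (r : X → X) (x : SolSpace r) : shiftInv r (shift r x) = x := rfl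

lemma shift_image (r : X → X) (A : Set (SolSpace r)) : shift r '' A = shiftInv r ⁻¹' A := by
  ext x
  constructor
  · rintro ⟨y, hy, rfl⟩
    exact hy
  · intro hx
    exact ⟨shiftInv r x, hx, shift_shiftInv r x⟩

lemma qi_iff (r : X → X) [MeasurableSpace X]
    (V : X → ℝ) (hV : Measurable V) (hVb : IsBdd V) (hVpos : ∀ x, 0 ≤ V x)
    (ν : Measure (SolSpace r)) [IsFiniteMeasure ν] :
    (∀ f : SolSpace r → ℝ, Measurable f → IsBdd f →
      ∫ x, f (shiftInv r x) ∂ν = ∫ x, f x * V (theta r 0 x) ∂ν) ↔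
    ν.map (shiftInv r) = ν.withDensity (fun x => ENNReal.ofReal (V (theta r 0 x))) := by
  have hW : Measurable fun x : SolSpace r => V (theta r 0 x) := hV.comp (measurable_theta r 0)
  have hT := measurable_shiftInv r
  obtain ⟨C, hC⟩ := hVb
  have hint : Integrable (fun x : SolSpace r => V (theta r 0 x)) ν :=
    Integrable.of_bound hW.aestronglyMeasurable C (ae_of_all _ fun x => hC _)
  constructor
  · intro h
    ext A hA
    rw [Measure.map_apply hT hA, withDensity_apply _ hA]
    have h1 := h (A.indicator 1) (measurable_one.indicator hA) ⟨1, fun x => by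
      by_cases hx : x ∈ A <;> simp [hx]⟩
    have e1 : ∀ x, (A.indicator (1 : SolSpace r → ℝ)) (shiftInv r x)
        = (shiftInv r ⁻¹' A).indicator 1 x := fun x => rfl
    have e2 : ∀ x, (A.indicator (1 : SolSpace r → ℝ)) x * V (theta r 0 x)
        = A.indicator (fun x => V (theta r 0 x)) x := fun x => by
      by_cases hx : x ∈ A <;> simp [hx]
    simp_rw [e1, e2] at h1
    rw [integral_indicator_one (hT hA), integral_indicator hA] at h1
    rw [← ofReal_integral_eq_lintegral_ofReal hint.integrableOn
      (ae_of_all _ fun x => hVpos _), ← h1, ofReal_measureReal]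
  · intro h f hf _
    rw [← integral_map hT.aemeasurable hf.aestronglyMeasurable, h,
      integral_withDensity_eq_integral_toReal_smul hW.ennreal_ofReal
        (ae_of_all _ fun x => ENNReal.ofReal_lt_top)]
    refine integral_congr_ae (ae_of_all _ fun x => ?_)
    simp [ENNReal.toReal_ofReal (hVpos _), mul_comm]

lemma eq_of_ergodic (r : X → X) [MeasurableSpace X] (hr : Measurable r)
    (W : SolSpace r → ℝ≥0∞) (hW : Measurable W)
    (μ ν : Measure (SolSpace r)) [IsProbabilityMeasure μ] [IsProbabilityMeasure ν]
    (hμ : μ.map (shiftInv r) = μ.withDensity W) (hν : ν.map (shiftInv r) = ν.withDensity W)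
    (hac : ν ≪ μ)
    (herg : ∀ A : Set (SolSpace r), MeasurableSet A → shift r '' A = A →
      (∫⁻ x in A, W x ∂μ = 0 ∨ ∫⁻ x in Aᶜ, W x ∂μ = 0)) : ν = μ := by
  have hT := measurable_shiftInv r
  have hS := measurable_shift r hr
  set m := μ.withDensity W with hm
  have hmfin : IsProbabilityMeasure m := by
    rw [← hμ]; exact Measure.isProbabilityMeasure_map hT.aemeasurable
  have hmμ : m ≪ μ := withDensity_absolutelyContinuous _ _
  have hqmp : Measure.QuasiMeasurePreserving (shiftInv r) m m :=
    ⟨hT, (hmμ.map hT).trans (by rw [hμ])⟩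
  have hqe : QuasiErgodic (shiftInv r) m := by
    refine ⟨hqmp, ⟨fun A hA hAA => ?_⟩⟩
    rw [eventuallyConst_set']
    rcases herg A hA (by rw [shift_image, hAA]) with h | h
    · left
      rw [ae_eq_empty, hm, withDensity_apply _ hA, h]
    · right
      rw [ae_eq_univ, hm, withDensity_apply _ hA.compl, h]
  set h := ν.rnDeriv μ with hh
  have hhm : Measurable h := Measure.measurable_rnDeriv _ _
  have hνh : μ.withDensity h = ν := Measure.withDensity_rnDeriv_eq _ _ hac
  have hd : m.withDensity h = m.withDensity (h ∘ shift r) := by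
    have a1 : ν.withDensity W = m.withDensity h := by
      rw [← hνh, hm, ← withDensity_mul _ hhm hW, ← withDensity_mul _ hW hhm, mul_comm]
    rw [← a1, ← hν, ← hνh]
    ext A hA
    rw [Measure.map_apply hT hA, withDensity_apply _ (hT hA), withDensity_apply _ hA, ← hμ,
      setLIntegral_map hA (hhm.comp hS) hT]
    simp [shift_shiftInv]
  have hae : h =ᵐ[m] h ∘ shift r := by
    refine (withDensity_eq_iff hhm.aemeasurable (hhm.comp hS).aemeasurable ?_).1 hd
    rw [← setLIntegral_univ, ← withDensity_apply _ MeasurableSet.univ]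
    have : m.withDensity h = ν.map (shiftInv r) := by
      rw [hν, ← hνh, hm, ← withDensity_mul _ hhm hW, ← withDensity_mul _ hW hhm, mul_comm]
    rw [this, Measure.map_apply hT MeasurableSet.univ]
    exact measure_ne_top _ _
  have hae2 : h ∘ shiftInv r =ᵐ[m] h := by
    have := hqmp.ae_eq_comp hae
    refine this.trans (ae_of_all _ fun x => ?_)
    simp [shift_shiftInv]
  obtain ⟨c, hc⟩ := hqe.ae_eq_const_of_ae_eq_comp₀ hhm.nullMeasurable hae2
  have hc2 : ∀ᵐ x ∂m, h (shift r x) = c := by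
    filter_upwards [hae, hc] with x h1 h2
    exact h1.symm.trans h2
  have hc3 : h =ᵐ[μ] fun _ => c := by
    rw [← hμ] at hc2
    have := ae_of_ae_map hT.aemeasurable hc2
    filter_upwards [this] with x hx
    rwa [shift_shiftInv] at hx
  have hfin : ν = c • μ := by
    rw [← hνh, withDensity_congr_ae hc3, withDensity_const]
  have : c = 1 := by
    have := congrArg (fun ρ : Measure (SolSpace r) => ρ univ) hfin
    simpa using this.symm
  rw [hfin, this, one_smul]

lemma qi_cond (r : X → X) [MeasurableSpace X] (W : SolSpace r → ℝ≥0∞)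
    (μ : Measure (SolSpace r)) (hμ : μ.map (shiftInv r) = μ.withDensity W)
    (c : ℝ≥0∞) (A : Set (SolSpace r)) (hA : MeasurableSet A) (hAA : shiftInv r ⁻¹' A = A) :
    (c • μ.restrict A).map (shiftInv r) = (c • μ.restrict A).withDensity W := by
  rw [Measure.map_smul, withDensity_smul_measure, ← restrict_withDensity hA, ← hμ,
    Measure.restrict_map (measurable_shiftInv r) hA, hAA]

end Helpers

/-- Theorem 7.2 (i)⟺(ii): a `V`-quasi-invariant probability measure `μ̂` is an extreme
point of the set of all `V`-quasi-invariant probability measures iff the measure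
`(V∘θ₀) dμ̂` is ergodic with respect to `r̂`. -/
theorem stmt18 [MeasurableSpace X] [TopologicalSpace X] [CompactSpace X] [T2Space X]
    [BorelSpace X]
    (r : X → X) (hr : Continuous r) (hsurj : Function.Surjective r)
    (hfin : ∀ x : X, (r ⁻¹' {x}).Finite)
    (V : X → ℝ) (hV : Measurable V) (hVb : IsBdd V) (hVpos : ∀ x, 0 ≤ V x)
    (μhat : Measure (SolSpace r)) [IsProbabilityMeasure μhat]
    (hqi : ∀ f : SolSpace r → ℝ, Measurable f → IsBdd f →
      ∫ x, f (shiftInv r x) ∂μhat = ∫ x, f x * V (theta r 0 x) ∂μhat) :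
    (∀ μhat1 μhat2 : Measure (SolSpace r),
      (IsProbabilityMeasure μhat1 ∧
        ∀ f : SolSpace r → ℝ, Measurable f → IsBdd f →
          ∫ x, f (shiftInv r x) ∂μhat1 = ∫ x, f x * V (theta r 0 x) ∂μhat1) →
      (IsProbabilityMeasure μhat2 ∧
        ∀ f : SolSpace r → ℝ, Measurable f → IsBdd f →
          ∫ x, f (shiftInv r x) ∂μhat2 = ∫ x, f x * V (theta r 0 x) ∂μhat2) →
      ∀ lam : ℝ, 0 < lam → lam < 1 →
        μhat = ENNReal.ofReal lam • μhat1 + ENNReal.ofReal (1 - lam) • μhat2 →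
        μhat1 = μhat ∧ μhat2 = μhat) ↔
    ∀ A : Set (SolSpace r), MeasurableSet A → shift r '' A = A →
      (∫⁻ x in A, ENNReal.ofReal (V (theta r 0 x)) ∂μhat = 0 ∨
        ∫⁻ x in Aᶜ, ENNReal.ofReal (V (theta r 0 x)) ∂μhat = 0) := by
  have hWm : Measurable fun x : SolSpace r => ENNReal.ofReal (V (theta r 0 x)) :=
    (hV.comp (measurable_theta r 0)).ennreal_ofReal
  have hμ := (qi_iff r V hV hVb hVpos μhat).1 hqi
  constructor
  · intro hext A hA hSA
    have hAA : shiftInv r ⁻¹' A = A := by rw [← shift_image, hSA]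
    have hAAc : shiftInv r ⁻¹' Aᶜ = Aᶜ := by rw [preimage_compl, hAA]
    have key : ∀ B : Set (SolSpace r), MeasurableSet B → shiftInv r ⁻¹' B = B →
        ∫⁻ x in B, ENNReal.ofReal (V (theta r 0 x)) ∂μhat = μhat B := by
      intro B hB hBB
      rw [← withDensity_apply _ hB, ← hμ, Measure.map_apply (measurable_shiftInv r) hB, hBB]
    rw [key A hA hAA, key Aᶜ hA.compl hAAc]
    by_contra hcon
    push Not at hcon
    obtain ⟨h0, h1⟩ := hcon
    have hp : ∀ B : Set (SolSpace r), μhat B ≠ 0 →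
        IsProbabilityMeasure ((μhat B)⁻¹ • μhat.restrict B) := by
      intro B hB
      constructor
      simp [ENNReal.inv_mul_cancel hB (measure_ne_top _ _)]
    have hp1 := hp A h0
    have hp2 := hp Aᶜ h1
    have hl0 : 0 < μhat.real A := ENNReal.toReal_pos h0 (measure_ne_top _ _)
    have hl1 : 0 < μhat.real Aᶜ := ENNReal.toReal_pos h1 (measure_ne_top _ _)
    have hcompl : 1 - μhat.real A = μhat.real Aᶜ := (probReal_compl_eq_one_sub hA).symm
    have hres := hext _ _
      ⟨hp1, (qi_iff r V hV hVb hVpos _).2 (qi_cond r _ μhat hμ (μhat A)⁻¹ A hA hAA)⟩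
      ⟨hp2, (qi_iff r V hV hVb hVpos _).2 (qi_cond r _ μhat hμ (μhat Aᶜ)⁻¹ Aᶜ hA.compl hAAc)⟩
      (μhat.real A) hl0 (by linarith) (by
        rw [hcompl, ofReal_measureReal, ofReal_measureReal, smul_smul, smul_smul,
          ENNReal.mul_inv_cancel h0 (measure_ne_top _ _),
          ENNReal.mul_inv_cancel h1 (measure_ne_top _ _), one_smul, one_smul,
          Measure.restrict_add_restrict_compl hA])
    apply h1
    rw [← hres.1]
    simp [hA.compl]
  · rintro herg μ1 μ2 ⟨hp1, hq1⟩ ⟨hp2, hq2⟩ lam hl0 hl1 heq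
    have hl0' : ENNReal.ofReal lam ≠ 0 := by simpa using hl0
    have hl1' : ENNReal.ofReal (1 - lam) ≠ 0 := by simpa using hl1
    have hac : ∀ B, μhat B = 0 → μ1 B = 0 ∧ μ2 B = 0 := by
      intro B hB
      rw [heq] at hB
      simpa [hl0', hl1', hl0.not_ge, hl1.not_ge] using hB
    exact ⟨eq_of_ergodic r hr.measurable _ hWm μhat μ1 hμ
        ((qi_iff r V hV hVb hVpos μ1).1 hq1) (fun B hB => (hac B hB).1) herg,
      eq_of_ergodic r hr.measurable _ hWm μhat μ2 hμ
        ((qi_iff r V hV hVb hVpos μ2).1 hq2) (fun B hB => (hac B hB).2) herg⟩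
end

section
/- Let V : X → [0,∞) be bounded and measurable, and let μ₀ be a probability measure on X with T_V(μ₀) = μ₀. Then μ₀ is an extreme point of the convex set M_1^V(X) of all probability measures μ on X with T_V(μ) = μ if and only if μ₀ is relatively ergodic with respect to (r, V), i.e., every non-negative bounded measurable function f on X satisfying E_{μ₀}(Vf) = E_{μ₀}(V)·(f∘r) pointwise μ₀∘r^{-1}-a.e. is constant μ₀-a.e. (Extreme point means: whenever μ₀ = λμ₁ + (1−λ)μ₂ with μ₁, μ₂ ∈ M_1^V(X) and λ ∈ (0,1), then μ₁ = μ₂ = μ₀.) -/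
open MeasureTheory Filter Topology Set

variable {X : Type*}

section Helpers

theorem IsBdd.mul_aux {α : Type*} {f g : α → ℝ} (hf : IsBdd f) (hg : IsBdd g) :
    IsBdd (fun x => f x * g x) := by
  obtain ⟨C, hC⟩ := hf
  obtain ⟨D, hD⟩ := hg
  refine ⟨C * D, fun x => ?_⟩
  rw [abs_mul]
  exact mul_le_mul (hC x) (hD x) (abs_nonneg _) ((abs_nonneg _).trans (hC x))

theorem IsBdd.comp_aux {α β : Type*} {f : α → ℝ} (hf : IsBdd f) (r : β → α) :
    IsBdd (fun x => f (r x)) := by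
  obtain ⟨C, hC⟩ := hf
  exact ⟨C, fun x => hC _⟩

theorem IsBdd.integrable_aux [MeasurableSpace X] {μ : Measure X} [IsFiniteMeasure μ]
    {f : X → ℝ} (hf : Measurable f) (hb : IsBdd f) : Integrable f μ := by
  obtain ⟨C, hC⟩ := hb
  exact Integrable.of_bound hf.aestronglyMeasurable C (Eventually.of_forall hC)

theorem integral_dens_aux [MeasurableSpace X] {μ : Measure X}
    {h : X → ℝ} (hm : Measurable h) (h0 : ∀ x, 0 ≤ h x) (g : X → ℝ) :
    ∫ x, g x ∂(μ.withDensity fun x => ENNReal.ofReal (h x)) = ∫ x, h x * g x ∂μ := by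
  rw [integral_withDensity_eq_integral_toReal_smul hm.ennreal_ofReal (by simp)]
  simp [ENNReal.toReal_ofReal (h0 _)]

theorem dens_exists_aux [MeasurableSpace X] {μ0 μ1 : Measure X} [IsProbabilityMeasure μ0]
    [IsProbabilityMeasure μ1] {lam : ℝ} (hl : 0 < lam) (hle : ENNReal.ofReal lam • μ1 ≤ μ0) :
    ∃ f : X → ℝ, Measurable f ∧ IsBdd f ∧ (∀ x, 0 ≤ f x) ∧
      μ1 = μ0.withDensity fun x => ENNReal.ofReal (f x) := by
  have hle' : μ1 ≤ ENNReal.ofReal lam⁻¹ • μ0 := by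
    refine Measure.le_iff.2 fun s _ => ?_
    have h1 : ENNReal.ofReal lam * μ1 s ≤ μ0 s := by simpa using hle s
    calc μ1 s = ENNReal.ofReal lam⁻¹ * (ENNReal.ofReal lam * μ1 s) := by
          rw [← mul_assoc, ← ENNReal.ofReal_mul (by positivity), inv_mul_cancel₀ hl.ne']
          simp
      _ ≤ ENNReal.ofReal lam⁻¹ * μ0 s := by gcongr
      _ = _ := by simp
  have hac : μ1 ≪ μ0 := Measure.absolutelyContinuous_of_le_smul hle'
  have hae : μ1.rnDeriv μ0 ≤ᵐ[μ0] fun _ => ENNReal.ofReal lam⁻¹ := by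
    refine ae_le_of_forall_setLIntegral_le_of_sigmaFinite (Measure.measurable_rnDeriv _ _) ?_
    intro s hs _
    rw [Measure.setLIntegral_rnDeriv hac]
    simpa using hle' s
  refine ⟨fun x => min (μ1.rnDeriv μ0 x).toReal lam⁻¹,
    (Measure.measurable_rnDeriv _ _).ennreal_toReal.min measurable_const,
    ⟨lam⁻¹, fun x => ?_⟩, fun x => ?_, ?_⟩
  · rw [abs_of_nonneg (by positivity)]
    exact min_le_right _ _
  · positivity
  · conv_lhs => rw [← Measure.withDensity_rnDeriv_eq μ1 μ0 hac]
    refine withDensity_congr_ae ?_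
    filter_upwards [hae] with x hx
    have hne : μ1.rnDeriv μ0 x ≠ ⊤ := ne_top_of_le_ne_top ENNReal.ofReal_ne_top hx
    rw [min_eq_left (ENNReal.toReal_le_of_le_ofReal (by positivity) hx), ENNReal.ofReal_toReal hne]

theorem condexp_exists_aux [mX : MeasurableSpace X] {μ0 : Measure X} [IsProbabilityMeasure μ0]
    {r : X → X} (hr : Measurable r) {V : X → ℝ} (hV : Measurable V) (hVb : IsBdd V) :
    ∃ EV : X → ℝ, Measurable[MeasurableSpace.comap r mX] EV ∧ IsBdd EV ∧
      ∀ g : X → ℝ, Measurable g → IsBdd g →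
        ∫ x, V x * g (r x) ∂μ0 = ∫ x, EV x * g (r x) ∂μ0 := by
  obtain ⟨C, hC⟩ := id hVb
  have hbd : ∀ᵐ x ∂μ0, |(μ0[V | MeasurableSpace.comap r mX]) x| ≤ C :=
    ae_bdd_abs_condExp_of_ae_bdd_abs (Eventually.of_forall hC)
  refine ⟨fun x => max (-C) (min ((μ0[V | MeasurableSpace.comap r mX]) x) C), ?_, ⟨|C|, ?_⟩, ?_⟩
  · have hm : Measurable[MeasurableSpace.comap r mX] (μ0[V | MeasurableSpace.comap r mX]) :=
      stronglyMeasurable_condExp.measurable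
    exact (Measurable.max measurable_const (Measurable.min hm measurable_const))
  · intro x
    rw [abs_le]
    constructor
    · exact (neg_le_neg (le_abs_self C)).trans (le_max_left _ _)
    · exact max_le (neg_le_abs C) ((min_le_right _ _).trans (le_abs_self C))
  · intro g hg hgb
    have hgr : Measurable[MeasurableSpace.comap r mX] (fun x => g (r x)) :=
      hg.comp (comap_measurable r)
    have h1 := condExp_mul_of_stronglyMeasurable_right (μ := μ0)
      (m := MeasurableSpace.comap r mX) (f := V) (g := fun x => g (r x))
      hgr.stronglyMeasurable
      (IsBdd.integrable_aux (hV.mul (hg.comp hr)) (hVb.mul_aux (hgb.comp_aux r)))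
      (IsBdd.integrable_aux hV hVb)
    have h2 : ∫ x, (μ0[V * fun x => g (r x) | MeasurableSpace.comap r mX]) x ∂μ0
      = ∫ x, (V * fun x => g (r x)) x ∂μ0 := integral_condExp hr.comap_le
    calc ∫ x, V x * g (r x) ∂μ0 = _ := h2.symm
      _ = _ := by
        refine integral_congr_ae ?_
        filter_upwards [h1, hbd] with x hx hb
        rw [hx, Pi.mul_apply, min_eq_left (abs_le.1 hb).2, max_eq_right (abs_le.1 hb).1]

/-- The measure `f μ₀` is fixed when `f` satisfies the integrated invariance relation. -/
theorem fixed_dens_aux [MeasurableSpace X] {μ0 : Measure X} {r : X → X} {V h : X → ℝ}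
    (hm : Measurable h) (h0 : ∀ x, 0 ≤ h x)
    (hh : ∀ g : X → ℝ, Measurable g → IsBdd g →
      ∫ x, h x * g x ∂μ0 = ∫ x, V x * h x * g (r x) ∂μ0) :
    ∀ g : X → ℝ, Measurable g → IsBdd g →
      ∫ x, g x ∂(μ0.withDensity fun x => ENNReal.ofReal (h x)) =
        ∫ x, g (r x) * V x ∂(μ0.withDensity fun x => ENNReal.ofReal (h x)) := by
  intro g hg hgb
  rw [integral_dens_aux hm h0, integral_dens_aux hm h0, hh g hg hgb]
  congr 1 with x
  ring

theorem prob_dens_aux [MeasurableSpace X] {μ0 : Measure X} {h : X → ℝ}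
    (hi : Integrable h μ0) (h0 : ∀ x, 0 ≤ h x) (h1 : ∫ x, h x ∂μ0 = 1) :
    IsProbabilityMeasure (μ0.withDensity fun x => ENNReal.ofReal (h x)) := by
  refine ⟨?_⟩
  rw [withDensity_apply _ MeasurableSet.univ, Measure.restrict_univ,
    ← ofReal_integral_eq_lintegral_ofReal hi (Eventually.of_forall h0), h1]
  simp

theorem ergodic_imp_aux [MeasurableSpace X] {r : X → X} (hr : Measurable r)
    {V : X → ℝ} (hV : Measurable V) (hVb : IsBdd V)
    {μ0 : Measure X} [IsProbabilityMeasure μ0]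
    (hfix : ∀ f : X → ℝ, Measurable f → IsBdd f →
      ∫ x, f x ∂μ0 = ∫ x, f (r x) * V x ∂μ0)
    (H : ∀ f : X → ℝ, Measurable f → IsBdd f → (∀ x, 0 ≤ f x) →
      ∀ EVf EV : X → ℝ,
        (Measurable[MeasurableSpace.comap r inferInstance] EVf ∧ IsBdd EVf ∧
          ∀ g : X → ℝ, Measurable g → IsBdd g →
            ∫ x, V x * f x * g (r x) ∂μ0 = ∫ x, EVf x * g (r x) ∂μ0) →
        (Measurable[MeasurableSpace.comap r inferInstance] EV ∧ IsBdd EV ∧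
          ∀ g : X → ℝ, Measurable g → IsBdd g →
            ∫ x, V x * g (r x) ∂μ0 = ∫ x, EV x * g (r x) ∂μ0) →
        (EVf =ᵐ[μ0] fun x => EV x * f (r x)) →
        ∃ c : ℝ, f =ᵐ[μ0] fun _ => c)
    {μ1 : Measure X} [IsProbabilityMeasure μ1]
    (h1 : ∀ f : X → ℝ, Measurable f → IsBdd f →
      ∫ x, f x ∂μ1 = ∫ x, f (r x) * V x ∂μ1)
    {lam : ℝ} (hl : 0 < lam) (hle : ENNReal.ofReal lam • μ1 ≤ μ0) : μ1 = μ0 := by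
  obtain ⟨f, hf, hfb, hf0, rfl⟩ := dens_exists_aux hl hle
  obtain ⟨EV, hEm, hEb, hE⟩ := condexp_exists_aux (μ0 := μ0) hr hV hVb
  obtain ⟨c, hc⟩ := H f hf hfb hf0 (fun x => EV x * f (r x)) EV
    ⟨hEm.mul (hf.comp (comap_measurable r)), hEb.mul_aux (hfb.comp_aux r), fun g hg hgb => by
      have e1 := h1 g hg hgb
      rw [integral_dens_aux hf hf0, integral_dens_aux hf hf0] at e1
      have e2 := hfix (fun x => f x * g x) (hf.mul hg) (hfb.mul_aux hgb)
      have e3 := hE (fun x => f x * g x) (hf.mul hg) (hfb.mul_aux hgb)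
      calc ∫ x, V x * f x * g (r x) ∂μ0 = ∫ x, f x * (g (r x) * V x) ∂μ0 := by
            congr 1 with x; ring
        _ = ∫ x, f (r x) * g (r x) * V x ∂μ0 := e1.symm.trans e2
        _ = ∫ x, V x * (f (r x) * g (r x)) ∂μ0 := by congr 1 with x; ring
        _ = ∫ x, EV x * (f (r x) * g (r x)) ∂μ0 := e3
        _ = _ := by congr 1 with x; ring⟩ ⟨hEm, hEb, hE⟩ (ae_eq_refl _)
  have hw : (μ0.withDensity fun x => ENNReal.ofReal (f x)) = ENNReal.ofReal c • μ0 := by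
    rw [← withDensity_const]
    refine withDensity_congr_ae ?_
    filter_upwards [hc] with x hx
    rw [hx]
  have hu : (μ0.withDensity fun x => ENNReal.ofReal (f x)) univ = 1 := measure_univ
  rw [hw] at hu ⊢
  simp only [Measure.smul_apply, measure_univ, smul_eq_mul, mul_one] at hu
  rw [hu, one_smul]

end Helpers

/-- Theorem 7.2 (iii)⟺(iv): a probability measure `μ₀` with `T_V(μ₀) = μ₀` is an extreme
point of the set of all such probability measures iff `μ₀` is relatively ergodic with
respect to `(r, V)`. -/
theorem stmt19 [MeasurableSpace X] [TopologicalSpace X] [CompactSpace X] [T2Space X]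
    [BorelSpace X]
    (r : X → X) (hr : Continuous r) (hsurj : Function.Surjective r)
    (hfin : ∀ x : X, (r ⁻¹' {x}).Finite)
    (V : X → ℝ) (hV : Measurable V) (hVb : IsBdd V) (hVpos : ∀ x, 0 ≤ V x)
    (μ0 : Measure X) [IsProbabilityMeasure μ0]
    (hfix : ∀ f : X → ℝ, Measurable f → IsBdd f →
      ∫ x, f x ∂μ0 = ∫ x, f (r x) * V x ∂μ0) :
    (∀ μ1 μ2 : Measure X,
      (IsProbabilityMeasure μ1 ∧
        ∀ f : X → ℝ, Measurable f → IsBdd f →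
          ∫ x, f x ∂μ1 = ∫ x, f (r x) * V x ∂μ1) →
      (IsProbabilityMeasure μ2 ∧
        ∀ f : X → ℝ, Measurable f → IsBdd f →
          ∫ x, f x ∂μ2 = ∫ x, f (r x) * V x ∂μ2) →
      ∀ lam : ℝ, 0 < lam → lam < 1 →
        μ0 = ENNReal.ofReal lam • μ1 + ENNReal.ofReal (1 - lam) • μ2 →
        μ1 = μ0 ∧ μ2 = μ0) ↔
    ∀ f : X → ℝ, Measurable f → IsBdd f → (∀ x, 0 ≤ f x) →
      ∀ EVf EV : X → ℝ,
        (Measurable[MeasurableSpace.comap r inferInstance] EVf ∧ IsBdd EVf ∧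
          ∀ g : X → ℝ, Measurable g → IsBdd g →
            ∫ x, V x * f x * g (r x) ∂μ0 = ∫ x, EVf x * g (r x) ∂μ0) →
        (Measurable[MeasurableSpace.comap r inferInstance] EV ∧ IsBdd EV ∧
          ∀ g : X → ℝ, Measurable g → IsBdd g →
            ∫ x, V x * g (r x) ∂μ0 = ∫ x, EV x * g (r x) ∂μ0) →
        (EVf =ᵐ[μ0] fun x => EV x * f (r x)) →
        ∃ c : ℝ, f =ᵐ[μ0] fun _ => c := by
  have hrm : Measurable r := hr.measurable
  constructor
  · intro H f hf hfb hf0 EVf EV hEVf hEV hae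
    obtain ⟨-, -, hEf⟩ := hEVf
    obtain ⟨-, -, hE⟩ := hEV
    have key : ∀ g : X → ℝ, Measurable g → IsBdd g →
        ∫ x, f x * g x ∂μ0 = ∫ x, V x * f x * g (r x) ∂μ0 := by
      intro g hg hgb
      have e2 := hfix (fun x => f x * g x) (hf.mul hg) (hfb.mul_aux hgb)
      have e3 := hE (fun x => f x * g x) (hf.mul hg) (hfb.mul_aux hgb)
      calc ∫ x, f x * g x ∂μ0 = ∫ x, f (r x) * g (r x) * V x ∂μ0 := e2
        _ = ∫ x, V x * (f (r x) * g (r x)) ∂μ0 := by congr 1 with x; ring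
        _ = ∫ x, EV x * (f (r x) * g (r x)) ∂μ0 := e3
        _ = ∫ x, EVf x * g (r x) ∂μ0 := by
          refine integral_congr_ae ?_
          filter_upwards [hae] with x hx
          rw [hx]; ring
        _ = _ := (hEf g hg hgb).symm
    have hfi : Integrable f μ0 := IsBdd.integrable_aux hf hfb
    obtain ⟨C, hC⟩ := id hfb
    set m := ∫ x, f x ∂μ0 with hm
    have hm0 : 0 ≤ m := integral_nonneg hf0
    rcases hm0.eq_or_lt with hz | hpos
    · exact ⟨0, (integral_eq_zero_iff_of_nonneg hf0 hfi).1 hz.symm⟩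
    have hmC : m ≤ C := by
      have : m ≤ ∫ _, C ∂μ0 :=
        integral_mono hfi (integrable_const _) fun x => (le_abs_self _).trans (hC x)
      simpa using this
    have hD : 0 < C + 1 - m := by linarith
    have hC1 : 0 < C + 1 := by linarith
    have hfC : ∀ x, 0 ≤ C + 1 - f x := fun x => by
      have := (le_abs_self _).trans (hC x)
      linarith
    set h1 : X → ℝ := fun x => m⁻¹ * f x with hh1
    set h2 : X → ℝ := fun x => (C + 1 - m)⁻¹ * (C + 1 - f x) with hh2
    have h1m : Measurable h1 := hf.const_mul _
    have h2m : Measurable h2 := (measurable_const.sub hf).const_mul _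
    have h10 : ∀ x, 0 ≤ h1 x := fun x => mul_nonneg (by positivity) (hf0 x)
    have h20 : ∀ x, 0 ≤ h2 x := fun x => mul_nonneg (by positivity) (hfC x)
    have h1i : Integrable h1 μ0 := hfi.const_mul _
    have h2i : Integrable h2 μ0 := ((integrable_const _).sub hfi).const_mul _
    have p1 := prob_dens_aux h1i h10 (by
      rw [hh1, integral_const_mul, ← hm, inv_mul_cancel₀ hpos.ne'])
    have p2 := prob_dens_aux h2i h20 (by
      rw [hh2, integral_const_mul, integral_sub (integrable_const _) hfi, ← hm]
      simp [inv_mul_cancel₀ hD.ne'])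
    have k1 := fixed_dens_aux (μ0 := μ0) (r := r) (V := V) h1m h10 (by
      intro g hg hgb
      calc ∫ x, h1 x * g x ∂μ0 = ∫ x, m⁻¹ * (f x * g x) ∂μ0 := by
            congr 1 with x; simp only [hh1]; ring
        _ = ∫ x, m⁻¹ * (V x * f x * g (r x)) ∂μ0 := by
            rw [integral_const_mul, integral_const_mul, key g hg hgb]
        _ = _ := by congr 1 with x; simp only [hh1]; ring)
    have k2 := fixed_dens_aux (μ0 := μ0) (r := r) (V := V) h2m h20 (by
      intro g hg hgb
      have i1 : Integrable (fun x => (C + 1) * g x) μ0 :=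
        (IsBdd.integrable_aux hg hgb).const_mul _
      have i2 : Integrable (fun x => f x * g x) μ0 :=
        IsBdd.integrable_aux (hf.mul hg) (hfb.mul_aux hgb)
      have i3 : Integrable (fun x => (C + 1) * (g (r x) * V x)) μ0 :=
        (IsBdd.integrable_aux ((hg.comp hrm).mul hV)
          ((hgb.comp_aux r).mul_aux hVb)).const_mul _
      have i4 : Integrable (fun x => V x * f x * g (r x)) μ0 :=
        IsBdd.integrable_aux ((hV.mul hf).mul (hg.comp hrm))
          ((hVb.mul_aux hfb).mul_aux (hgb.comp_aux r))
      calc ∫ x, h2 x * g x ∂μ0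
          = ∫ x, (C + 1 - m)⁻¹ * ((C + 1) * g x - f x * g x) ∂μ0 := by
            congr 1 with x; simp only [hh2]; ring
        _ = ∫ x, (C + 1 - m)⁻¹ * ((C + 1) * (g (r x) * V x) - V x * f x * g (r x)) ∂μ0 := by
            rw [integral_const_mul, integral_const_mul, integral_sub i1 i2, integral_sub i3 i4,
              key g hg hgb, integral_const_mul, integral_const_mul, hfix g hg hgb]
        _ = _ := by congr 1 with x; simp only [hh2]; ring)
    have hlt : m / (C + 1) < 1 := by rw [div_lt_one hC1]; linarith
    have hfin := (H _ _ ⟨p1, k1⟩ ⟨p2, k2⟩ (m / (C + 1)) (by positivity) hlt (by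
      rw [← withDensity_smul _ h1m.ennreal_ofReal, ← withDensity_smul _ h2m.ennreal_ofReal,
        ← withDensity_add_left (h1m.ennreal_ofReal.const_smul _)]
      conv_lhs => rw [← withDensity_one (μ := μ0)]
      congr 1
      ext x
      simp only [Pi.add_apply, Pi.smul_apply, smul_eq_mul, Pi.one_apply]
      rw [← ENNReal.ofReal_mul (by positivity), ← ENNReal.ofReal_mul (by linarith),
        ← ENNReal.ofReal_add (mul_nonneg (by positivity) (h10 x))
          (mul_nonneg (by linarith) (h20 x)), ← ENNReal.ofReal_one]
      congr 1
      simp only [hh1, hh2]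
      field_simp
      ring)).1
    have hone : (μ0.withDensity fun x => ENNReal.ofReal (h1 x)) = μ0.withDensity 1 := by
      rw [hfin, withDensity_one]
    have hx := (withDensity_eq_iff_of_sigmaFinite h1m.ennreal_ofReal.aemeasurable
      aemeasurable_const).1 hone
    refine ⟨m, ?_⟩
    filter_upwards [hx] with x hx
    have : h1 x = 1 := by simpa using hx
    simp only [hh1] at this
    field_simp at this
    exact this
  · rintro H μ1 μ2 ⟨p1, k1⟩ ⟨p2, k2⟩ lam hl0 hl1 heq
    constructor
    · refine ergodic_imp_aux hrm hV hVb hfix H k1 hl0 ?_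
      conv_rhs => rw [heq]
      exact Measure.le_add_right le_rfl
    · refine ergodic_imp_aux hrm hV hVb hfix H k2 (sub_pos.2 hl1) ?_
      conv_rhs => rw [heq]
      exact Measure.le_add_left le_rfl
end
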